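/- arXiv:0711.4940 — 3 statements merged into one kernel-verified Lean document; each statement's English description precedes it below -/
import Mathlib

section
/- Let m₂ < m₁ be nonnegative integers, n = m₁+m₂+1, and f, g ∈ C^{n+2}(0,∞) with f^{(n+1)} and g^{(n+1)} never zero. Then M_{f,m₁,m₂}(a,b) = M_{g,m₁,m₂}(a,b) for all 0 < a < b if and only if there exist a constant c ≠ 0 and a polynomial p of degree at most n with g(x) = c·f(x) + p(x) for all x > 0. -/
/-- `IsDD f x y z r s D` says that `D` is the value of the confluent divided difference
`f[x, y^r, z^s]` (node `y` repeated `r` times, node `z` repeated `s` times), characterized as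
the leading coefficient of the Hermite interpolant of degree at most `r + s` matching `f` at
`x` and matching `f` and its derivatives up to order `r - 1` at `y` and `s - 1` at `z`. -/
def IsDD (f : ℝ → ℝ) (x y z : ℝ) (r s : ℕ) (D : ℝ) : Prop :=
  ∃ H : Polynomial ℝ, H.natDegree ≤ r + s ∧ H.coeff (r + s) = D ∧
    H.eval x = f x ∧
    (∀ j < r, iteratedDeriv j (fun t => H.eval t) y = iteratedDeriv j f y) ∧
    (∀ j < s, iteratedDeriv j (fun t => H.eval t) z = iteratedDeriv j f z)

open Set Filter Topology Asymptotics

/-- The Rolle theorem for finitely many zeros. -/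
theorem exists_finset_deriv_eq_zero {a b : ℝ} {u : ℝ → ℝ} (hu : ContinuousOn u (Icc a b))
    {q : ℕ} (S : Finset ℝ) (hS : S.card = q + 1) (hab : ∀ z ∈ S, z ∈ Icc a b)
    (h0 : ∀ z ∈ S, u z = 0) :
    ∃ T : Finset ℝ, T.card = q ∧ ∀ z ∈ T, z ∈ Ioo a b ∧ deriv u z = 0 := by
  have hmem : ∀ i, S.orderEmbOfFin hS i ∈ S := S.orderEmbOfFin_mem hS
  have hrolle : ∀ i : Fin q, ∃ c ∈ Ioo (S.orderEmbOfFin hS i.castSucc) (S.orderEmbOfFin hS i.succ),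
      deriv u c = 0 := fun i =>
    exists_deriv_eq_zero ((S.orderEmbOfFin hS).strictMono i.castSucc_lt_succ)
      (hu.mono (Icc_subset_Icc (hab _ (hmem _)).1 (hab _ (hmem _)).2))
      ((h0 _ (hmem _)).trans (h0 _ (hmem _)).symm)
  choose c hc hc0 using hrolle
  have hmono : StrictMono c := fun i j hij =>
    ((hc i).2.trans_le ((S.orderEmbOfFin hS).monotone (Fin.succ_le_castSucc_iff.mpr hij))).trans
      (hc j).1
  refine ⟨Finset.univ.image c, ?_, fun z hz => ?_⟩
  · rw [Finset.card_image_of_injective _ hmono.injective, Finset.card_fin]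
  · obtain ⟨i, -, rfl⟩ := Finset.mem_image.mp hz
    exact ⟨⟨(hab _ (hmem _)).1.trans_lt (hc i).1, (hc i).2.trans_le (hab _ (hmem _)).2⟩, hc0 i⟩

theorem ContDiffOn.continuousOn_iteratedDeriv_of_isOpen {u : ℝ → ℝ} {s : Set ℝ} (hs : IsOpen s)
    {N j : ℕ} (hu : ContDiffOn ℝ N u s) (hj : j ≤ N) : ContinuousOn (iteratedDeriv j u) s :=
  (hu.continuousOn_iteratedDerivWithin (mod_cast hj) hs.uniqueDiffOn).congr
    fun _ hx => (iteratedDerivWithin_of_isOpen hs hx).symm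

/-- The Rolle theorem for a function with zeros of multiplicities `r` and `s` at the endpoints and a
further zero inside. -/
theorem exists_iteratedDeriv_eq_zero_of_confluent {a b x : ℝ} (hx : x ∈ Ioo a b) {u : ℝ → ℝ}
    {r s : ℕ} (hu : ∀ j < r + s, ContinuousOn (iteratedDeriv j u) (Icc a b)) (h0 : u x = 0)
    (ha : ∀ j < r, iteratedDeriv j u a = 0) (hb : ∀ j < s, iteratedDeriv j u b = 0) :
    ∃ ξ ∈ Ioo a b, iteratedDeriv (r + s) u ξ = 0 := by
  have hzeros : ∀ j ≤ r + s, ∃ T : Finset ℝ, T.card + j = 1 + min j r + min j s ∧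
      ∀ z ∈ T, z ∈ Ioo a b ∧ iteratedDeriv j u z = 0 := by
    intro j
    induction j with
    | zero => exact fun _ => ⟨{x}, by simp, by simpa using ⟨hx, h0⟩⟩
    | succ j ih =>
      intro hj
      obtain ⟨T, hT, hTz⟩ := ih (by omega)
      have haT : a ∉ T := fun h => lt_irrefl _ (hTz _ h).1.1
      have hbT : b ∉ T := fun h => lt_irrefl _ (hTz _ h).1.2
      have hab : a < b := hx.1.trans hx.2
      let A : Finset ℝ := if j < r then {a} else ∅
      let B : Finset ℝ := if j < s then {b} else ∅
      have hA : ∀ z ∈ A, z = a ∧ j < r := by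
        intro z hz; by_cases h : j < r <;> simp_all [A]
      have hB : ∀ z ∈ B, z = b ∧ j < s := by
        intro z hz; by_cases h : j < s <;> simp_all [B]
      have hAc : A.card = if j < r then 1 else 0 := by
        by_cases h : j < r <;> simp [A, h]
      have hBc : B.card = if j < s then 1 else 0 := by
        by_cases h : j < s <;> simp [B, h]
      have hd1 : Disjoint A B := Finset.disjoint_left.mpr fun z h1 h2 =>
        hab.ne ((hA z h1).1.symm.trans (hB z h2).1)
      have hd2 : Disjoint (A ∪ B) T := by
        refine Finset.disjoint_left.mpr fun z h1 h2 => ?_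
        rcases Finset.mem_union.mp h1 with h | h
        · exact haT ((hA z h).1 ▸ h2)
        · exact hbT ((hB z h).1 ▸ h2)
      have hcard : (A ∪ B ∪ T).card + j = 1 + min (j + 1) r + min (j + 1) s := by
        rw [Finset.card_union_of_disjoint hd2, Finset.card_union_of_disjoint hd1, hAc, hBc]
        split_ifs <;> omega
      obtain ⟨U, hU, hUz⟩ := exists_finset_deriv_eq_zero (hu j (by omega)) (A ∪ B ∪ T)
        (q := (A ∪ B ∪ T).card - 1) (by omega)
        (fun z hz => by
          rcases Finset.mem_union.mp hz with h | h
          · rcases Finset.mem_union.mp h with h | h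
            · rw [(hA z h).1]; exact left_mem_Icc.mpr hab.le
            · rw [(hB z h).1]; exact right_mem_Icc.mpr hab.le
          · exact Ioo_subset_Icc_self (hTz z h).1)
        (fun z hz => by
          rcases Finset.mem_union.mp hz with h | h
          · rcases Finset.mem_union.mp h with h | h
            · rw [(hA z h).1]; exact ha j (hA z h).2
            · rw [(hB z h).1]; exact hb j (hB z h).2
          · exact (hTz z h).2)
      exact ⟨U, by omega, by simpa only [iteratedDeriv_succ] using hUz⟩
  obtain ⟨T, hT, hTz⟩ := hzeros (r + s) le_rfl
  obtain ⟨ξ, hξ⟩ := Finset.card_pos.mp (show 0 < T.card by omega)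
  exact ⟨ξ, hTz ξ hξ⟩

namespace Polynomial

theorem iteratedDeriv_eval (p : ℝ[X]) (j : ℕ) :
    iteratedDeriv j (fun t => p.eval t) = fun t => (derivative^[j] p).eval t := by
  induction j with
  | zero => simp
  | succ j ih =>
    rw [iteratedDeriv_succ, ih, Function.iterate_succ_apply']
    ext t
    exact Polynomial.deriv _

theorem contDiff_eval (p : ℝ[X]) {N : WithTop ℕ∞} : ContDiff ℝ N fun t => p.eval t := by
  simpa using p.contDiff_aeval N (𝕜 := ℝ) (R := ℝ)

theorem iterate_derivative_eval_of_natDegree_le {p : ℝ[X]} {N : ℕ} (hp : p.natDegree ≤ N + 1)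
    (t : ℝ) : (derivative^[N] p).eval t =
      N.factorial * p.coeff N + (N + 1).factorial * p.coeff (N + 1) * t := by
  have hdeg : (derivative^[N] p).natDegree ≤ 1 :=
    (natDegree_iterate_derivative p N).trans (by omega)
  rw [eq_X_add_C_of_natDegree_le_one hdeg]
  simp only [coeff_iterate_derivative, eval_add, eval_mul, eval_C, eval_X, zero_add,
    nsmul_eq_mul, Nat.descFactorial_self, add_comm 1 N]
  rw [show (N + 1).descFactorial N = (N + 1).factorial by
    have := Nat.factorial_mul_descFactorial (show N ≤ N + 1 by omega)
    simpa using this]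
  ring

theorem iteratedDeriv_eval_eq_zero_of_pow_dvd {p : ℝ[X]} {y : ℝ} {r j : ℕ} (hj : j < r)
    (h : (X - C y) ^ r ∣ p) : iteratedDeriv j (fun t => p.eval t) y = 0 := by
  rw [iteratedDeriv_eval]
  exact ((dvd_pow_self _ (by omega)).trans
    (pow_sub_dvd_iterate_derivative_of_pow_dvd j h)) |> dvd_iff_isRoot.mp

end Polynomial

open Polynomial

/-- The mean value property of confluent divided differences, with a free parameter `c` obtained
by adding `c` times the node polynomial to the Hermite interpolant. -/
theorem IsDD.exists_iteratedDeriv_eq {f : ℝ → ℝ} {x a b D : ℝ} {r s : ℕ}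
    (h : IsDD f x a b r s D) (hx : x ∈ Ioo a b) {U : Set ℝ} (hU : IsOpen U)
    (hab : Icc a b ⊆ U) (hf : ContDiffOn ℝ (r + s : ℕ) f U) (c : ℝ) :
    ∃ ξ ∈ Ioo a b, iteratedDeriv (r + s) f ξ = (r + s).factorial * D +
      c * ((r + s + 1).factorial * ξ - (r + s).factorial * (x + r * a + s * b)) := by
  obtain ⟨H, hdeg, hcoeff, hHx, hHa, hHb⟩ := h
  let w : Polynomial ℝ := (X - C x) * (X - C a) ^ r * (X - C b) ^ s
  have hma : ((X - C a) ^ r : Polynomial ℝ).Monic := (monic_X_sub_C a).pow r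
  have hmb : ((X - C b) ^ s : Polynomial ℝ).Monic := (monic_X_sub_C b).pow s
  have hmxa : ((X - C x) * (X - C a) ^ r : Polynomial ℝ).Monic := (monic_X_sub_C x).mul hma
  have hwm : w.Monic := hmxa.mul hmb
  have hwd : w.natDegree = r + s + 1 := by
    rw [hmxa.natDegree_mul hmb, (monic_X_sub_C x).natDegree_mul hma,
      (monic_X_sub_C a).natDegree_pow, (monic_X_sub_C b).natDegree_pow]
    simp only [natDegree_X_sub_C]
    ring
  have hwN : w.coeff (r + s) = -(x + r * a + s * b) := by
    have hnext : w.nextCoeff = w.coeff (r + s) := by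
      rw [nextCoeff_of_natDegree_pos (by omega), hwd, Nat.add_sub_cancel]
    rw [← hnext, hmxa.nextCoeff_mul hmb, (monic_X_sub_C x).nextCoeff_mul hma,
      (monic_X_sub_C a).nextCoeff_pow, (monic_X_sub_C b).nextCoeff_pow]
    simp only [nextCoeff_X_sub_C, nsmul_eq_mul]
    ring
  have hwN1 : w.coeff (r + s + 1) = 1 := by rw [← hwd]; exact hwm.coeff_natDegree
  have hsum : ∀ (j : ℕ) (t : ℝ), iteratedDeriv j (fun t => (H + C c * w).eval t) t =
      iteratedDeriv j (fun t => H.eval t) t + c * iteratedDeriv j (fun t => w.eval t) t := by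
    intro j t
    rw [iteratedDeriv_eval, iteratedDeriv_eval, iteratedDeriv_eval, iterate_map_add,
      iterate_derivative_C_mul]
    simp only [eval_add, eval_mul, eval_C]
  have hsub : ∀ j ≤ r + s, ∀ t ∈ U, iteratedDeriv j (fun t => f t - (H + C c * w).eval t) t =
      iteratedDeriv j f t - iteratedDeriv j (fun t => (H + C c * w).eval t) t := by
    intro j hj t ht
    exact iteratedDeriv_fun_sub ((hf.contDiffAt (hU.mem_nhds ht)).of_le (mod_cast hj))
      (contDiff_eval _).contDiffAt
  have hlt : a < b := hx.1.trans hx.2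
  obtain ⟨ξ, hξ, hξ0⟩ := exists_iteratedDeriv_eq_zero_of_confluent hx (r := r) (s := s)
    (u := fun t => f t - (H + C c * w).eval t)
    (fun j hj => ((hf.sub (contDiff_eval _).contDiffOn).continuousOn_iteratedDeriv_of_isOpen
      hU hj.le).mono hab)
    (by simp [w, hHx])
    (fun j hj => by
      rw [hsub j (by omega) a (hab (left_mem_Icc.mpr hlt.le)), hsum, hHa j hj,
        iteratedDeriv_eval_eq_zero_of_pow_dvd hj (p := w)
          (Dvd.intro_left _ rfl |>.mul_right _)]
      ring)
    (fun j hj => by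
      rw [hsub j (by omega) b (hab (right_mem_Icc.mpr hlt.le)), hsum, hHb j hj,
        iteratedDeriv_eval_eq_zero_of_pow_dvd hj (p := w) (Dvd.intro_left _ rfl)]
      ring)
  refine ⟨ξ, hξ, ?_⟩
  rw [hsub _ le_rfl ξ (hab (Ioo_subset_Icc_self hξ)), hsum, iteratedDeriv_eval,
    iteratedDeriv_eval] at hξ0
  simp only [iterate_derivative_eval_of_natDegree_le (hdeg.trans (Nat.le_succ _)),
    iterate_derivative_eval_of_natDegree_le hwd.le, hcoeff, hwN, hwN1,
    coeff_eq_zero_of_natDegree_lt (Nat.lt_succ_of_le hdeg)] at hξ0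
  linear_combination hξ0

/-- Divided differences of `g` and `f` are proportional when `g - c f` is a polynomial of smaller
degree than the order of the divided difference. -/
theorem IsDD.eq_mul_of_eq_add_polynomial {f g : ℝ → ℝ} {x a b D E c : ℝ} {r s : ℕ}
    (hD : IsDD f x a b r s D) (hE : IsDD g x a b r s E) (hx : x ∈ Ioo a b) {U : Set ℝ}
    (hU : IsOpen U) (hab : Icc a b ⊆ U) (hf : ContDiffOn ℝ (r + s : ℕ) f U)
    {p : Polynomial ℝ} (hp : p.natDegree < r + s)
    (hg : ∀ t ∈ U, g t = c * f t + p.eval t) : E = c * D := by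
  obtain ⟨H, hHd, hHc, hHx, hHa, hHb⟩ := hD
  obtain ⟨K, hKd, hKc, hKx, hKa, hKb⟩ := hE
  have hlt : a < b := hx.1.trans hx.2
  have heq : ∀ y ∈ U, g =ᶠ[𝓝 y] fun t => c * f t + p.eval t := fun y hy =>
    Filter.eventually_of_mem (hU.mem_nhds hy) hg
  have hder : ∀ y ∈ U, ∀ j ≤ r + s, iteratedDeriv j g y =
      c * iteratedDeriv j f y + iteratedDeriv j (fun t => p.eval t) y := by
    intro y hy j hj
    have hfy := (hf.contDiffAt (hU.mem_nhds hy)).of_le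
      (show ((j : ℕ) : WithTop ℕ∞) ≤ (r + s : ℕ) from mod_cast hj)
    rw [(heq y hy).iteratedDeriv_eq, iteratedDeriv_fun_add (contDiffAt_const.mul hfy)
      (contDiff_eval _).contDiffAt, iteratedDeriv_const_mul_field]
  have hdd : IsDD (fun t => p.eval t) x a b r s (E - c * D) := by
    have hsum : ∀ (j : ℕ) (t : ℝ), iteratedDeriv j (fun t => (K - C c * H).eval t) t =
        iteratedDeriv j (fun t => K.eval t) t - c * iteratedDeriv j (fun t => H.eval t) t := by
      intro j t
      rw [iteratedDeriv_eval, iteratedDeriv_eval, iteratedDeriv_eval, iterate_derivative_sub,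
        iterate_derivative_C_mul]
      simp only [eval_sub, eval_mul, eval_C]
    refine ⟨K - C c * H, ?_, by simp [hHc, hKc], ?_, fun j hj => ?_, fun j hj => ?_⟩
    · exact (natDegree_sub_le _ _).trans (max_le hKd ((natDegree_C_mul_le _ _).trans hHd))
    · simp [hHx, hKx, hg x (hab (Ioo_subset_Icc_self hx))]
    · rw [hsum, hHa j hj, hKa j hj, hder a (hab (left_mem_Icc.mpr hlt.le)) j (by omega)]
      ring
    · rw [hsum, hHb j hj, hKb j hj, hder b (hab (right_mem_Icc.mpr hlt.le)) j (by omega)]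
      ring
  obtain ⟨ξ, -, hξ⟩ := hdd.exists_iteratedDeriv_eq hx hU hab (contDiff_eval _).contDiffOn 0
  rw [iteratedDeriv_eval, iterate_derivative_eq_zero hp] at hξ
  have : ((r + s).factorial : ℝ) ≠ 0 := mod_cast Nat.factorial_ne_zero _
  simp [this] at hξ
  linarith

/-- A function whose derivative of order `n + 1` vanishes on `(0, ∞)` is there a polynomial of
degree at most `n`. -/
theorem exists_polynomial_of_iteratedDeriv_eq_zero {u : ℝ → ℝ} {n : ℕ}
    (hu : ContDiffOn ℝ (n + 1 : ℕ) u (Ioi 0))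
    (h0 : ∀ x ∈ Ioi (0 : ℝ), iteratedDeriv (n + 1) u x = 0) :
    ∃ p : Polynomial ℝ, p.natDegree ≤ n ∧ ∀ x : ℝ, 0 < x → u x = p.eval x := by
  let p : Polynomial ℝ := ∑ k ∈ Finset.range (n + 1),
    C (iteratedDeriv k u 1 / k.factorial) * (X - C 1) ^ k
  refine ⟨p, natDegree_sum_le_of_forall_le _ _ fun k hk => ?_, fun x hx => ?_⟩
  · refine (natDegree_C_mul_le _ _).trans ?_
    rw [(monic_X_sub_C _).natDegree_pow, natDegree_X_sub_C]
    have := Finset.mem_range.mp hk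
    omega
  · have hp : p.eval x = ∑ k ∈ Finset.range (n + 1),
        iteratedDeriv k u 1 / k.factorial * (x - 1) ^ k := by
      simp [p, eval_finsetSum]
    rw [hp]
    rcases eq_or_ne 1 x with rfl | hne
    · simp [Finset.sum_range_succ']
    · have hsub : uIcc 1 x ⊆ Ioi 0 := fun t ht => (lt_min one_pos hx).trans_le ht.1
      obtain ⟨y, hy, hyx⟩ := taylor_mean_remainder_lagrange_iteratedDeriv hne
        (hu.mono hsub : ContDiffOn ℝ (n + 1 : ℕ) u _)
      rw [h0 y (hsub (Ioo_subset_Icc_self hy)), zero_mul, zero_div, sub_eq_zero,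
        taylor_within_apply] at hyx
      rw [hyx]
      refine Finset.sum_congr rfl fun k hk => ?_
      have hk' : k ≤ n + 1 := (Finset.mem_range.mp hk).le
      rw [iteratedDerivWithin_eq_iteratedDeriv (uniqueDiffOn_uIcc hne)
        ((hu.contDiffAt (Ioi_mem_nhds one_pos)).of_le (mod_cast hk')) left_mem_uIcc, smul_eq_mul]
      ring

theorem ContDiffOn.hasDerivAt_iteratedDeriv_of_isOpen {u : ℝ → ℝ} {s : Set ℝ} (hs : IsOpen s)
    {N : ℕ} (hu : ContDiffOn ℝ (N + 1 : ℕ) u s) {y : ℝ} (hy : y ∈ s) :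
    HasDerivAt (iteratedDeriv N u) (iteratedDeriv (N + 1) u y) y := by
  have hd : DifferentiableOn ℝ (iteratedDeriv N u) s :=
    (hu.differentiableOn_iteratedDerivWithin (mod_cast N.lt_succ_self) hs.uniqueDiffOn).congr
      fun _ hx => (iteratedDerivWithin_of_isOpen hs hx).symm
  rw [iteratedDeriv_succ]
  exact (hd.differentiableAt (hs.mem_nhds hy)).hasDerivAt

theorem tendsto_nhdsGT_of_mem_Ioo {a : ℝ} {ξ : ℝ → ℝ} (hξ : ∀ b > a, ξ b ∈ Ioo a b) :
    Tendsto ξ (𝓝[>] a) (𝓝 a) := by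
  refine tendsto_of_tendsto_of_tendsto_of_le_of_le' tendsto_const_nhds
    (tendsto_nhdsWithin_of_tendsto_nhds tendsto_id) ?_ ?_
  · filter_upwards [self_mem_nhdsWithin] with b hb using (hξ b hb).1.le
  · filter_upwards [self_mem_nhdsWithin] with b hb using (hξ b hb).2.le

/-- The limit of confluent divided differences as the nodes coalesce. -/
theorem IsDD.tendsto_nhdsGT {f : ℝ → ℝ} {a : ℝ} (ha : 0 < a) {r s : ℕ}
    (hf : ContDiffOn ℝ (r + s : ℕ) f (Ioi 0)) {x F : ℝ → ℝ} (hx : ∀ b > a, x b ∈ Ioo a b)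
    (hF : ∀ b > a, IsDD f (x b) a b r s (F b)) :
    Tendsto F (𝓝[>] a) (𝓝 (iteratedDeriv (r + s) f a / (r + s).factorial)) := by
  have hmean : ∀ b, ∃ ξ, b > a → ξ ∈ Ioo a b ∧
      iteratedDeriv (r + s) f ξ / (r + s).factorial = F b := by
    intro b
    by_cases hb : b > a
    · obtain ⟨ξ, hξ, h⟩ := (hF b hb).exists_iteratedDeriv_eq (hx b hb) isOpen_Ioi
        (fun t ht => ha.trans_le ht.1) hf 0
      refine ⟨ξ, fun _ => ⟨hξ, ?_⟩⟩
      rw [h]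
      field_simp
      ring
    · exact ⟨0, fun h => absurd h hb⟩
  choose ξ hξ using hmean
  have hcont := (hf.continuousOn_iteratedDeriv_of_isOpen isOpen_Ioi le_rfl).continuousAt
    (Ioi_mem_nhds ha)
  refine ((hcont.tendsto.comp (tendsto_nhdsGT_of_mem_Ioo fun b hb => (hξ b hb).1)).div_const
    ((r + s).factorial : ℝ)).congr' ?_
  filter_upwards [self_mem_nhdsWithin] with b hb using (hξ b hb).2

/-- The first-order behaviour of the difference of two confluent divided differences with
interchanged multiplicities as the nodes coalesce. -/
theorem IsDD.tendsto_sub_div_nhdsGT {f : ℝ → ℝ} {a : ℝ} (ha : 0 < a) {r s : ℕ}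
    (hf : ContDiffOn ℝ (r + s + 1 : ℕ) f (Ioi 0)) {x F G : ℝ → ℝ} (hx : ∀ b > a, x b ∈ Ioo a b)
    (hF : ∀ b > a, IsDD f (x b) a b r s (F b)) (hG : ∀ b > a, IsDD f (x b) a b s r (G b)) :
    Tendsto (fun b => (G b - F b) / (b - a)) (𝓝[>] a)
      (𝓝 (iteratedDeriv (r + s + 1) f a * (r - s) / (r + s + 1).factorial)) := by
  set K := iteratedDeriv (r + s) f
  set K' := iteratedDeriv (r + s + 1) f a
  have hf₀ : ContDiffOn ℝ (r + s : ℕ) f (Ioi 0) := hf.of_le (mod_cast Nat.le_succ _)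
  have hlittle : ∀ ξ : ℝ → ℝ, (∀ b > a, ξ b ∈ Ioo a b) →
      Tendsto (fun b => (K (ξ b) - K a - (ξ b - a) * K') / (b - a)) (𝓝[>] a) (𝓝 0) := by
    intro ξ hξ
    have h1 : (fun b => K (ξ b) - K a - (ξ b - a) * K') =o[𝓝[>] a] fun b => ξ b - a :=
      (hf.hasDerivAt_iteratedDeriv_of_isOpen isOpen_Ioi ha).isLittleO.comp_tendsto
        (tendsto_nhdsGT_of_mem_Ioo hξ)
    refine (h1.trans_isBigO (k := fun b => b - a)
      (IsBigO.of_bound 1 ?_)).tendsto_div_nhds_zero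
    filter_upwards [self_mem_nhdsWithin] with b hb
    have := hξ b hb
    simp only [Real.norm_eq_abs, one_mul]
    rw [abs_of_pos (sub_pos.mpr this.1), abs_of_pos (sub_pos.mpr hb)]
    linarith [this.2]
  have hmean : ∀ b, ∃ ξ η, b > a → ξ ∈ Ioo a b ∧ η ∈ Ioo a b ∧
      K ξ = (r + s).factorial * F b + K' / (r + s + 1).factorial *
        ((r + s + 1).factorial * ξ - (r + s).factorial * (x b + r * a + s * b)) ∧
      K η = (r + s).factorial * G b + K' / (r + s + 1).factorial *
        ((r + s + 1).factorial * η - (r + s).factorial * (x b + s * a + r * b)) := by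
    intro b
    by_cases hb : b > a
    · have hsub : Icc a b ⊆ Ioi 0 := fun t ht => ha.trans_le ht.1
      obtain ⟨ξ, hξ, h⟩ := (hF b hb).exists_iteratedDeriv_eq (hx b hb) isOpen_Ioi hsub hf₀
        (K' / (r + s + 1).factorial)
      obtain ⟨η, hη, h'⟩ := (hG b hb).exists_iteratedDeriv_eq (hx b hb) isOpen_Ioi hsub
        (by rwa [add_comm s r]) (K' / (r + s + 1).factorial)
      rw [add_comm s r] at h'
      exact ⟨ξ, η, fun _ => ⟨hξ, hη, h, h'⟩⟩
    · exact ⟨0, 0, fun h => absurd h hb⟩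
  choose ξ η hξη using hmean
  have hlim := ((hlittle η fun b hb => (hξη b hb).2.1).sub
    (hlittle ξ fun b hb => (hξη b hb).1)).div_const ((r + s).factorial : ℝ)
    |>.add_const (K' * (r - s) / (r + s + 1).factorial)
  simp only [sub_zero, zero_div, zero_add] at hlim
  refine hlim.congr' ?_
  filter_upwards [self_mem_nhdsWithin] with b hb
  obtain ⟨-, -, h, h'⟩ := hξη b hb
  have hba : b - a ≠ 0 := (sub_pos.mpr hb).ne'
  have hfac : ((r + s).factorial : ℝ) ≠ 0 := mod_cast Nat.factorial_ne_zero _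
  have hfac' : ((r + s + 1).factorial : ℝ) ≠ 0 := mod_cast Nat.factorial_ne_zero _
  rw [h, h']
  field_simp
  ring

/-- If the Wronskian of two differentiable functions without zeros vanishes on `(0, ∞)`, then one
is a nonzero multiple of the other. -/
theorem exists_eq_mul_of_wronskian_eq_zero {φ ψ φ' ψ' : ℝ → ℝ}
    (hφ : ∀ x ∈ Ioi (0 : ℝ), HasDerivAt φ (φ' x) x) (hψ : ∀ x ∈ Ioi (0 : ℝ), HasDerivAt ψ (ψ' x) x)
    (hφ0 : ∀ x ∈ Ioi (0 : ℝ), φ x ≠ 0) (hψ0 : ∀ x ∈ Ioi (0 : ℝ), ψ x ≠ 0)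
    (hW : ∀ x ∈ Ioi (0 : ℝ), φ x * ψ' x = ψ x * φ' x) :
    ∃ c : ℝ, c ≠ 0 ∧ ∀ x ∈ Ioi (0 : ℝ), ψ x = c * φ x := by
  have hder : ∀ x ∈ Ioi (0 : ℝ), HasDerivAt (fun t => ψ t / φ t) 0 x := fun x hx => by
    refine ((hψ x hx).div (hφ x hx) (hφ0 x hx)).congr_deriv ?_
    rw [div_eq_zero_iff]
    left
    linear_combination hW x hx
  have h1 : (1 : ℝ) ∈ Ioi (0 : ℝ) := mem_Ioi.mpr one_pos
  refine ⟨ψ 1 / φ 1, div_ne_zero (hψ0 1 h1) (hφ0 1 h1), fun x hx => ?_⟩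
  have hconst : ψ x / φ x = ψ 1 / φ 1 := isOpen_Ioi.is_const_of_deriv_eq_zero
    isPreconnected_Ioi (fun y hy => (hder y hy).differentiableAt.differentiableWithinAt)
    (fun y hy => (hder y hy).deriv) hx h1
  rw [← hconst, div_mul_cancel₀ _ (hφ0 x hx)]

theorem stmt13 (m₁ m₂ : ℕ) (hm : m₂ < m₁) (n : ℕ) (hn : n = m₁ + m₂ + 1)
    (f g : ℝ → ℝ)
    (hf : ContDiffOn ℝ (n + 2 : ℕ) f (Set.Ioi 0)) (hg : ContDiffOn ℝ (n + 2 : ℕ) g (Set.Ioi 0))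
    (hf' : ∀ x ∈ Set.Ioi (0 : ℝ), iteratedDerivWithin (n + 1) f (Set.Ioi 0) x ≠ 0)
    (hg' : ∀ x ∈ Set.Ioi (0 : ℝ), iteratedDerivWithin (n + 1) g (Set.Ioi 0) x ≠ 0)
    (Ff Gf Fg Gg : ℝ → ℝ → ℝ → ℝ)
    (hFf : ∀ a b : ℝ, 0 < a → a < b → ∀ x ∈ Set.Ioo a b,
      IsDD f x a b (m₁ + 1) (m₂ + 1) (Ff x a b))
    (hGf : ∀ a b : ℝ, 0 < a → a < b → ∀ x ∈ Set.Ioo a b,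
      IsDD f x a b (m₂ + 1) (m₁ + 1) (Gf x a b))
    (hFg : ∀ a b : ℝ, 0 < a → a < b → ∀ x ∈ Set.Ioo a b,
      IsDD g x a b (m₁ + 1) (m₂ + 1) (Fg x a b))
    (hGg : ∀ a b : ℝ, 0 < a → a < b → ∀ x ∈ Set.Ioo a b,
      IsDD g x a b (m₂ + 1) (m₁ + 1) (Gg x a b))
    (Mf Mg : ℝ → ℝ → ℝ)
    (hMf : ∀ a b : ℝ, 0 < a → a < b → Mf a b ∈ Set.Ioo a b ∧
      ∀ x ∈ Set.Ioo a b,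
        ((x - a) ^ (m₁ - m₂) * Ff x a b = (b - x) ^ (m₁ - m₂) * Gf x a b ↔ x = Mf a b))
    (hMg : ∀ a b : ℝ, 0 < a → a < b → Mg a b ∈ Set.Ioo a b ∧
      ∀ x ∈ Set.Ioo a b,
        ((x - a) ^ (m₁ - m₂) * Fg x a b = (b - x) ^ (m₁ - m₂) * Gg x a b ↔ x = Mg a b)) :
    (∀ a b : ℝ, 0 < a → a < b → Mf a b = Mg a b) ↔
      ∃ c : ℝ, c ≠ 0 ∧ ∃ p : Polynomial ℝ, p.natDegree ≤ n ∧
        ∀ x : ℝ, 0 < x → g x = c * f x + p.eval x := by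
  subst hn
  have hNf : m₁ + 1 + (m₂ + 1) = m₁ + m₂ + 1 + 1 := by ring
  have hNg : m₂ + 1 + (m₁ + 1) = m₁ + m₂ + 1 + 1 := by ring
  have hf₁ : ContDiffOn ℝ (m₁ + m₂ + 1 + 1 : ℕ) f (Ioi 0) := hf.of_le (mod_cast Nat.le_succ _)
  have hg₁ : ContDiffOn ℝ (m₁ + m₂ + 1 + 1 : ℕ) g (Ioi 0) := hg.of_le (mod_cast Nat.le_succ _)
  constructor
  · intro hM
    obtain ⟨c, hc, hcφ⟩ := exists_eq_mul_of_wronskian_eq_zero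
      (fun x hx => hf.hasDerivAt_iteratedDeriv_of_isOpen isOpen_Ioi hx)
      (fun x hx => hg.hasDerivAt_iteratedDeriv_of_isOpen isOpen_Ioi hx)
      (fun x hx => by rw [← iteratedDerivWithin_of_isOpen isOpen_Ioi hx]; exact hf' x hx)
      (fun x hx => by rw [← iteratedDerivWithin_of_isOpen isOpen_Ioi hx]; exact hg' x hx)
      (fun a ha => by
        have hx : ∀ b > a, Mf a b ∈ Ioo a b := fun b hb => (hMf a b ha hb).1
        have hFf' := fun b hb => hFf a b ha hb _ (hx b hb)
        have hGf' := fun b hb => hGf a b ha hb _ (hx b hb)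
        have hFg' := fun b hb => hFg a b ha hb _ (hx b hb)
        have hGg' := fun b hb => hGg a b ha hb _ (hx b hb)
        have hlim₁ := (IsDD.tendsto_nhdsGT ha (by rwa [hNf]) hx hFf').mul
          (IsDD.tendsto_sub_div_nhdsGT ha (by rwa [hNf]) hx hFg' hGg')
        have hlim₂ := (IsDD.tendsto_nhdsGT ha (by rwa [hNf]) hx hFg').mul
          (IsDD.tendsto_sub_div_nhdsGT ha (by rwa [hNf]) hx hFf' hGf')
        have heq := tendsto_nhds_unique_of_eventuallyEq hlim₁ hlim₂ (by
          filter_upwards [self_mem_nhdsWithin] with b hb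
          have h₁ := ((hMf a b ha hb).2 _ (hx b hb)).mpr rfl
          have h₂ := ((hMg a b ha hb).2 _ (hx b hb)).mpr (hM a b ha hb)
          have hv : (b - Mf a b) ^ (m₁ - m₂) ≠ 0 := (pow_pos (sub_pos.mpr (hx b hb).2) _).ne'
          rw [← mul_div_assoc, ← mul_div_assoc]
          congr 1
          apply mul_left_cancel₀ hv
          linear_combination Fg (Mf a b) a b * h₁ - Ff (Mf a b) a b * h₂)
        rw [hNf] at heq
        have hd : (((m₁ + 1 : ℕ) : ℝ) - ((m₂ + 1 : ℕ) : ℝ)) ≠ 0 :=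
          sub_ne_zero.mpr (mod_cast (by omega : m₁ + 1 ≠ m₂ + 1))
        have hfac : ((m₁ + m₂ + 1 + 1).factorial : ℝ) ≠ 0 := mod_cast Nat.factorial_ne_zero _
        have hfac' : ((m₁ + m₂ + 1 + 1 + 1).factorial : ℝ) ≠ 0 := mod_cast Nat.factorial_ne_zero _
        rw [div_mul_div_comm, div_mul_div_comm, div_left_inj' (mul_ne_zero hfac hfac'),
          ← mul_assoc, ← mul_assoc] at heq
        exact mul_right_cancel₀ hd heq)
    obtain ⟨p, hp, hpx⟩ := exists_polynomial_of_iteratedDeriv_eq_zero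
      (hg₁.sub (contDiffOn_const.mul hf₁) : ContDiffOn ℝ _ (fun x => g x - c * f x) _)
      (fun x hx => by
        have hfx := hf₁.contDiffAt (Ioi_mem_nhds hx)
        rw [iteratedDeriv_fun_sub (hg₁.contDiffAt (Ioi_mem_nhds hx)) (contDiffAt_const.mul hfx),
          iteratedDeriv_const_mul_field, hcφ x hx, sub_self])
    exact ⟨c, hc, p, hp, fun x hx => by rw [← hpx x hx]; ring⟩
  · rintro ⟨c, -, p, hp, hgx⟩ a b ha hab
    have hx := (hMf a b ha hab).1
    have hsub : Icc a b ⊆ Ioi 0 := fun t ht => ha.trans_le ht.1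
    have hF := (hFf a b ha hab _ hx).eq_mul_of_eq_add_polynomial (hFg a b ha hab _ hx) hx
      isOpen_Ioi hsub (by rwa [hNf]) (by omega) hgx
    have hG := (hGf a b ha hab _ hx).eq_mul_of_eq_add_polynomial (hGg a b ha hab _ hx) hx
      isOpen_Ioi hsub (by rwa [hNg]) (by omega) hgx
    refine ((hMg a b ha hab).2 _ hx).mp ?_
    rw [hF, hG]
    linear_combination c * ((hMf a b ha hab).2 _ hx).mpr rfl
end

section
/- For fixed nonnegative integers m₂ < m₁ and fixed 0 < a < b, the function p ↦ M_{p,m₁,m₂}(a,b) is strictly increasing in p (for real p outside {0, 1, ..., m₁+m₂+1}). -/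
open Set Filter Topology Polynomial

theorem AnalyticOnNhd.dslope_real {f : ℝ → ℝ} {S : Set ℝ} (hf : AnalyticOnNhd ℝ f S) {x : ℝ}
    (hx : x ∈ S) : AnalyticOnNhd ℝ (dslope f x) S := by
  intro y hy
  rcases eq_or_ne y x with rfl | hyx
  · obtain ⟨q, hq⟩ := hf y hy
    exact hq.has_fpower_series_dslope_fslope.analyticAt
  · refine AnalyticAt.congr ?_ (dslope_eventuallyEq_slope_of_ne f hyx).symm
    have hfy := hf y hy
    have : AnalyticAt ℝ (fun z => (z - x)⁻¹ * (f z - f x)) y := by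
      refine AnalyticAt.mul (AnalyticAt.inv (by fun_prop) (sub_ne_zero.2 hyx)) ?_
      exact hfy.sub analyticAt_const
    exact this

theorem AnalyticOnNhd.iteratedDeriv_real {f : ℝ → ℝ} {S : Set ℝ} (hf : AnalyticOnNhd ℝ f S)
    (n : ℕ) : AnalyticOnNhd ℝ (iteratedDeriv n f) S := by
  rw [iteratedDeriv_eq_iterate]
  exact hf.iterated_deriv n

theorem AnalyticOnNhd.hasDerivAt_iteratedDeriv {f : ℝ → ℝ} {S : Set ℝ}
    (hf : AnalyticOnNhd ℝ f S) (n : ℕ) {y : ℝ} (hy : y ∈ S) :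
    HasDerivAt (iteratedDeriv n f) (iteratedDeriv (n + 1) f y) y := by
  rw [iteratedDeriv_succ]
  exact (hf.iteratedDeriv_real n y hy).differentiableAt.hasDerivAt

/-- The Leibniz rule applied to `f y - f x = (y - x) * dslope f x y`. -/
theorem AnalyticOnNhd.iteratedDeriv_succ_eq_dslope {f : ℝ → ℝ} {S : Set ℝ} (hS : IsOpen S)
    (hf : AnalyticOnNhd ℝ f S) {x : ℝ} (hx : x ∈ S) (n : ℕ) :
    ∀ y ∈ S, iteratedDeriv (n + 1) f y =
      (y - x) * iteratedDeriv (n + 1) (dslope f x) y +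
        (n + 1) * iteratedDeriv n (dslope f x) y := by
  have hk := hf.dslope_real hx
  induction n with
  | zero =>
    intro y hy
    have h := (((hasDerivAt_id y).sub_const x).mul (hk.hasDerivAt_iteratedDeriv 0 hy)).add_const
      (f x)
    have hfun : f = fun z => (id z - x) * iteratedDeriv 0 (dslope f x) z + f x := by
      funext z
      have := sub_smul_dslope f x z
      simp only [smul_eq_mul] at this
      simp [this]
    have h1 : iteratedDeriv (0 + 1) f y = deriv f y := by simp
    rw [h1]
    have h2 : deriv f y = deriv (fun z => (id z - x) * iteratedDeriv 0 (dslope f x) z + f x) y :=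
      congrArg (fun g => deriv g y) hfun
    rw [h2]
    refine h.deriv.trans ?_
    simp only [id, CharP.cast_eq_zero]
    ring
  | succ n ih =>
    intro y hy
    have h := (((hasDerivAt_id y).sub_const x).mul
      (hk.hasDerivAt_iteratedDeriv (n + 1) hy)).add
      ((hk.hasDerivAt_iteratedDeriv n hy).const_mul ((n : ℝ) + 1))
    have he : iteratedDeriv (n + 1) f =ᶠ[𝓝 y] fun z =>
        (id z - x) * iteratedDeriv (n + 1) (dslope f x) z +
          ((n : ℝ) + 1) * iteratedDeriv n (dslope f x) z := by
      filter_upwards [hS.mem_nhds hy] with z hz using ih z hz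
    rw [iteratedDeriv_succ, he.deriv_eq]
    refine h.deriv.trans ?_
    simp only [id]
    push_cast
    ring

theorem iteratedDeriv_dslope_eq_zero {e : ℝ → ℝ} {S : Set ℝ} (hS : IsOpen S)
    (he : AnalyticOnNhd ℝ e S) {x y : ℝ} (hx : x ∈ S) (hy : y ∈ S) (hxy : y ≠ x) (hex : e x = 0)
    {r : ℕ} (hr : ∀ j < r, iteratedDeriv j e y = 0) :
    ∀ j < r, iteratedDeriv j (dslope e x) y = 0 := by
  intro j
  induction j with
  | zero =>
    intro h
    have h0 := hr 0 h
    have := sub_smul_dslope e x y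
    simp only [iteratedDeriv_zero] at h0 ⊢
    rw [h0, hex, sub_zero, smul_eq_mul] at this
    exact (mul_eq_zero.1 this).resolve_left (sub_ne_zero.2 hxy)
  | succ j ih =>
    intro h
    have h1 := he.iteratedDeriv_succ_eq_dslope hS hx j y hy
    rw [hr _ h, ih (by omega), mul_zero, add_zero] at h1
    exact (mul_eq_zero.1 h1.symm).resolve_left (sub_ne_zero.2 hxy)

/-- Repeated integration by parts when all boundary terms vanish. -/
theorem integral_mul_eq_zero_of_boundary {a b : ℝ} {u v : ℕ → ℝ → ℝ} (n : ℕ)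
    (hu : ∀ i, ∀ y ∈ uIcc a b, HasDerivAt (u i) (u (i + 1) y) y)
    (hv : ∀ i, ∀ y ∈ uIcc a b, HasDerivAt (v i) (v (i + 1) y) y)
    (ha : ∀ i j, i + j + 1 = n → u i a * v j a = 0)
    (hb : ∀ i j, i + j + 1 = n → u i b * v j b = 0)
    (hn : ∀ y ∈ uIcc a b, u n y = 0) :
    ∫ y in a..b, u 0 y * v n y = 0 := by
  have hint : ∀ w : ℕ → ℝ → ℝ, (∀ i, ∀ y ∈ uIcc a b, HasDerivAt (w i) (w (i + 1) y) y) →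
      ∀ i, IntervalIntegrable (w i) MeasureTheory.volume a b := fun w hw i =>
    ContinuousOn.intervalIntegrable fun y hy => (hw i y hy).continuousAt.continuousWithinAt
  suffices h : ∀ i j, i + j = n → ∫ y in a..b, u i y * v j y = 0 from h 0 n (by omega)
  intro i j
  induction j generalizing i with
  | zero =>
    intro hij
    obtain rfl : i = n := by omega
    rw [intervalIntegral.integral_congr (g := fun _ => (0 : ℝ))
      (fun y hy => by simp [hn y hy])]
    simp
  | succ j ih =>
    intro hij
    rw [intervalIntegral.integral_mul_deriv_eq_deriv_mul (hu i) (hv j) (hint u hu _)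
      (hint v hv _), ha i j (by omega), hb i j (by omega), ih (i + 1) (by omega)]
    simp

theorem iteratedDeriv_polynomial (P : ℝ[X]) (n : ℕ) :
    iteratedDeriv n (fun t => P.eval t) = fun t => (derivative^[n] P).eval t := by
  induction n with
  | zero => simp
  | succ n ih =>
    rw [iteratedDeriv_succ, ih]
    funext t
    rw [Polynomial.deriv, Function.iterate_succ_apply']

theorem eval_iterate_derivative_eq_zero_of_pow_dvd {P : ℝ[X]} {c : ℝ} {m j : ℕ}
    (h : (X - C c) ^ m ∣ P) (hj : j < m) : (derivative^[j] P).eval c = 0 := by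
  have h1 : (X - C c) ∣ derivative^[j] P :=
    (dvd_pow_self _ (by omega)).trans (pow_sub_dvd_iterate_derivative_of_pow_dvd j h)
  exact dvd_iff_isRoot.1 h1

theorem iterate_derivative_const_of_natDegree_le {H : ℝ[X]} {n : ℕ} (h : H.natDegree ≤ n) :
    derivative^[n] H = C ((n.factorial : ℝ) * H.coeff n) := by
  ext i
  rw [coeff_iterate_derivative, coeff_C]
  split_ifs with hi
  · subst hi
    simp [Nat.descFactorial_self]
  · rw [coeff_eq_zero_of_natDegree_lt (by omega), smul_zero]

/-- If `(t - x) θ' + (n + 1) θ = q`, then `q` is, up to a power, the derivative of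
`s ↦ s ^ (n + 1) θ(x + s (y - x))`. -/
theorem hasDerivAt_pow_mul_of_euler {θ θ' q : ℝ → ℝ} {S : Set ℝ} (hS : Convex ℝ S) {n : ℕ}
    {x y : ℝ} (hx : x ∈ S) (hy : y ∈ S) (hθ : ∀ t ∈ S, HasDerivAt θ (θ' t) t)
    (hode : ∀ t ∈ S, (t - x) * θ' t + (n + 1) * θ t = q t) {s : ℝ} (hs : s ∈ Icc (0 : ℝ) 1) :
    HasDerivAt (fun s => s ^ (n + 1) * θ (x + s * (y - x))) (s ^ n * q (x + s * (y - x))) s := by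
  have hmem : x + s * (y - x) ∈ S := by simpa using hS.add_smul_sub_mem hx hy hs
  have h1 : HasDerivAt (fun s : ℝ => x + s * (y - x)) (y - x) s := by
    simpa using ((hasDerivAt_id s).mul_const (y - x)).const_add x
  refine ((hasDerivAt_pow (n + 1) s).mul ((hθ _ hmem).comp s h1)).congr_deriv ?_
  rw [← hode _ hmem]
  simp only [Function.comp, Nat.add_sub_cancel]
  push_cast
  ring

theorem nonneg_of_euler {θ θ' q : ℝ → ℝ} {S : Set ℝ} (hS : Convex ℝ S) {n : ℕ} {x y : ℝ}
    (hx : x ∈ S) (hy : y ∈ S) (hθ : ∀ t ∈ S, HasDerivAt θ (θ' t) t)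
    (hode : ∀ t ∈ S, (t - x) * θ' t + (n + 1) * θ t = q t)
    (hq : ∀ t ∈ S, 0 ≤ q t) : 0 ≤ θ y := by
  have hd := fun s (hs : s ∈ Icc (0 : ℝ) 1) => hasDerivAt_pow_mul_of_euler hS hx hy hθ hode hs
  have hmono : MonotoneOn (fun s => s ^ (n + 1) * θ (x + s * (y - x))) (Icc 0 1) := by
    refine monotoneOn_of_deriv_nonneg (convex_Icc 0 1)
      (fun s hs => (hd s hs).continuousAt.continuousWithinAt)
      (fun s hs => ((hd s (interior_subset hs)).differentiableAt).differentiableWithinAt) ?_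
    intro s hs
    rw [(hd s (interior_subset hs)).deriv]
    have hs' := interior_subset hs
    exact mul_nonneg (pow_nonneg hs'.1 _)
      (hq _ (by simpa using hS.add_smul_sub_mem hx hy hs'))
  simpa using hmono (by simp) (by simp) zero_le_one

theorem pos_of_euler {θ θ' q : ℝ → ℝ} {S : Set ℝ} (hS : Convex ℝ S) {n : ℕ} {x y : ℝ}
    (hx : x ∈ S) (hy : y ∈ S) (hθ : ∀ t ∈ S, HasDerivAt θ (θ' t) t)
    (hode : ∀ t ∈ S, (t - x) * θ' t + (n + 1) * θ t = q t)
    (hq : ∀ s ∈ Ioo (0 : ℝ) 1, 0 < q (x + s * (y - x))) : 0 < θ y := by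
  have hd := fun s (hs : s ∈ Icc (0 : ℝ) 1) => hasDerivAt_pow_mul_of_euler hS hx hy hθ hode hs
  have hmono : StrictMonoOn (fun s => s ^ (n + 1) * θ (x + s * (y - x))) (Icc 0 1) := by
    refine strictMonoOn_of_deriv_pos (convex_Icc 0 1)
      (fun s hs => (hd s hs).continuousAt.continuousWithinAt) ?_
    intro s hs
    rw [(hd s (interior_subset hs)).deriv]
    rw [interior_Icc] at hs
    exact mul_pos (pow_pos hs.1 _) (hq s hs)
  simpa using hmono (by simp) (by simp) zero_lt_one

/-- A monotone l'Hôpital rule for solutions of Euler type equations. -/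
theorem strictMonoOn_div_of_euler {θ₁ θ₁' θ₂ θ₂' ψ φ : ℝ → ℝ} {S : Set ℝ} (hS : Convex ℝ S)
    {n : ℕ} {x : ℝ} (hx : x ∈ S) (h₁ : ∀ t ∈ S, HasDerivAt θ₁ (θ₁' t) t)
    (h₂ : ∀ t ∈ S, HasDerivAt θ₂ (θ₂' t) t)
    (hode₁ : ∀ t ∈ S, (t - x) * θ₁' t + (n + 1) * θ₁ t = ψ t)
    (hode₂ : ∀ t ∈ S, (t - x) * θ₂' t + (n + 1) * θ₂ t = φ t * ψ t)
    (hψ : ∀ t ∈ S, 0 < ψ t) (hφ : StrictMonoOn φ S) (hpos : ∀ t ∈ S, 0 < θ₁ t) :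
    StrictMonoOn (fun t => θ₂ t / θ₁ t) S := by
  have hmem : ∀ y ∈ S, ∀ s ∈ Ioo (0 : ℝ) 1, x + s * (y - x) ∈ S := fun y hy s hs => by
    simpa using hS.add_smul_sub_mem hx hy ⟨hs.1.le, hs.2.le⟩
  have hd : ∀ t ∈ S, HasDerivAt (fun t => θ₂ t / θ₁ t)
      ((θ₂' t * θ₁ t - θ₂ t * θ₁' t) / θ₁ t ^ 2) t :=
    fun t ht => (h₂ t ht).div (h₁ t ht) (hpos t ht).ne'
  have hcont : ContinuousOn (fun t => θ₂ t / θ₁ t) S :=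
    fun t ht => (hd t ht).continuousAt.continuousWithinAt
  have hkey : ∀ t ∈ S, (t - x) * (θ₂' t * θ₁ t - θ₂ t * θ₁' t) = ψ t * (φ t * θ₁ t - θ₂ t) := by
    intro t ht
    linear_combination θ₁ t * hode₂ t ht - θ₂ t * hode₁ t ht
  have hright : ∀ y ∈ S, x < y → 0 < φ y * θ₁ y - θ₂ y := by
    intro y hy hxy
    refine pos_of_euler (θ := fun t => φ y * θ₁ t - θ₂ t)
      (θ' := fun t => φ y * θ₁' t - θ₂' t) (q := fun t => (φ y - φ t) * ψ t) (n := n) hS hx hy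
      (fun t ht => ((h₁ t ht).const_mul _).sub (h₂ t ht)) (fun t ht => ?_) (fun s hs => ?_)
    · linear_combination φ y * hode₁ t ht - hode₂ t ht
    · refine mul_pos (sub_pos.2 (hφ (hmem y hy s hs) hy ?_)) (hψ _ (hmem y hy s hs))
      nlinarith [hs.2, hs.1]
  have hleft : ∀ y ∈ S, y < x → 0 < θ₂ y - φ y * θ₁ y := by
    intro y hy hxy
    refine pos_of_euler (θ := fun t => θ₂ t - φ y * θ₁ t)
      (θ' := fun t => θ₂' t - φ y * θ₁' t) (q := fun t => (φ t - φ y) * ψ t) (n := n) hS hx hy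
      (fun t ht => (h₂ t ht).sub ((h₁ t ht).const_mul _)) (fun t ht => ?_) (fun s hs => ?_)
    · linear_combination hode₂ t ht - φ y * hode₁ t ht
    · refine mul_pos (sub_pos.2 (hφ hy (hmem y hy s hs) ?_)) (hψ _ (hmem y hy s hs))
      nlinarith [hs.2, hs.1]
  have hR : StrictMonoOn (fun t => θ₂ t / θ₁ t) (S ∩ Ici x) := by
    refine strictMonoOn_of_deriv_pos (hS.inter (convex_Ici x)) (hcont.mono inter_subset_left) ?_
    intro t ht
    rw [interior_inter, interior_Ici] at ht
    have htS := interior_subset ht.1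
    have hxt : x < t := ht.2
    rw [(hd t htS).deriv]
    refine div_pos ?_ (pow_pos (hpos t htS) 2)
    refine pos_of_mul_pos_right ?_ (sub_pos.2 hxt).le
    rw [hkey t htS]
    exact mul_pos (hψ t htS) (hright t htS hxt)
  have hL : StrictMonoOn (fun t => θ₂ t / θ₁ t) (S ∩ Iic x) := by
    refine strictMonoOn_of_deriv_pos (hS.inter (convex_Iic x)) (hcont.mono inter_subset_left) ?_
    intro t ht
    rw [interior_inter, interior_Iic] at ht
    have htS := interior_subset ht.1
    have hxt : t < x := ht.2
    rw [(hd t htS).deriv]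
    refine div_pos ?_ (pow_pos (hpos t htS) 2)
    have h1 := mul_pos (hψ t htS) (hleft t htS hxt)
    have h2 := hkey t htS
    refine pos_of_mul_pos_right (a := x - t) ?_ (sub_pos.2 hxt).le
    linarith
  have hU := hL.union hR (c := x) ⟨⟨hx, self_mem_Iic⟩, fun t ht => ht.2⟩
    ⟨⟨hx, self_mem_Ici⟩, fun t ht => ht.2⟩
  rwa [← inter_union_distrib_left, Iic_union_Ici, inter_univ] at hU

/-- The Hermite-Genocchi type representation of the confluent divided difference. -/
theorem IsDD.integral_eq {f : ℝ → ℝ} {S : Set ℝ} (hS : IsOpen S) (hSc : Convex ℝ S)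
    (hf : AnalyticOnNhd ℝ f S) {a b x : ℝ} (haS : a ∈ S) (hbS : b ∈ S) (hx : x ∈ Ioo a b)
    {r s : ℕ} {D : ℝ} (h : IsDD f x a b (r + 1) (s + 1) D) :
    ∫ y in a..b, (y - a) ^ s * (b - y) ^ r * iteratedDeriv (r + s + 1) (dslope f x) y =
      ((r + s + 1).factorial * D) * ∫ y in a..b, (y - a) ^ s * (b - y) ^ r := by
  obtain ⟨H, hdeg, hD, hHx, hHa, hHb⟩ := h
  have hab : a < b := hx.1.trans hx.2
  have hIcc : uIcc a b ⊆ S := by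
    rw [uIcc_of_le hab.le]
    exact hSc.ordConnected.out haS hbS
  have hxS : x ∈ S := hIcc (by rw [uIcc_of_le hab.le]; exact ⟨hx.1.le, hx.2.le⟩)
  have hHan : AnalyticOnNhd ℝ (fun t => H.eval t) S := fun y _ => by
    simpa using AnalyticAt.aeval_polynomial (analyticAt_id (𝕜 := ℝ) (z := y)) H
  set e : ℝ → ℝ := fun t => f t - H.eval t with he
  have hean : AnalyticOnNhd ℝ e S := hf.sub hHan
  have hesub : ∀ j, ∀ y ∈ S, iteratedDeriv j e y =
      iteratedDeriv j f y - iteratedDeriv j (fun t => H.eval t) y := fun j y hy =>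
    iteratedDeriv_fun_sub (hf y hy).contDiffAt (hHan y hy).contDiffAt
  have hex : e x = 0 := by simp [he, hHx]
  have hka := iteratedDeriv_dslope_eq_zero hS hean hxS haS hx.1.ne hex (r := r + 1)
    (fun j hj => by rw [hesub j a haS, hHa j hj, sub_self])
  have hkb := iteratedDeriv_dslope_eq_zero hS hean hxS hbS hx.2.ne' hex (r := s + 1)
    (fun j hj => by rw [hesub j b hbS, hHb j hj, sub_self])
  have hfk := hf.dslope_real hxS
  have hek := hean.dslope_real hxS
  set n := r + s + 1 with hn
  set c : ℝ := n.factorial * D with hc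
  have hode : ∀ t ∈ S, (t - x) * (iteratedDeriv (n + 1) (dslope f x) t -
      iteratedDeriv (n + 1) (dslope e x) t) + (n + 1) * (iteratedDeriv n (dslope f x) t -
      iteratedDeriv n (dslope e x) t - c) = 0 := by
    intro t ht
    have h1 := hf.iteratedDeriv_succ_eq_dslope hS hxS n t ht
    have h2 := hean.iteratedDeriv_succ_eq_dslope hS hxS n t ht
    have h3 : iteratedDeriv (n + 1) (fun t => H.eval t) t = (n + 1) * c := by
      rw [iteratedDeriv_polynomial, iterate_derivative_const_of_natDegree_le (by omega)]
      simp only [eval_C]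
      rw [show n + 1 = r + 1 + (s + 1) by omega, hD, hc,
        show r + 1 + (s + 1) = n + 1 by omega, Nat.factorial_succ]
      push_cast
      ring
    have h4 := hesub (n + 1) t ht
    linear_combination h2 - h1 - h4 + h3
  have hderiv : ∀ t ∈ S, HasDerivAt (fun t => iteratedDeriv n (dslope f x) t -
      iteratedDeriv n (dslope e x) t - c) (iteratedDeriv (n + 1) (dslope f x) t -
      iteratedDeriv (n + 1) (dslope e x) t) t := fun t ht =>
    ((hfk.hasDerivAt_iteratedDeriv n ht).sub (hek.hasDerivAt_iteratedDeriv n ht)).sub_const c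
  have hsplit : ∀ y ∈ S, iteratedDeriv n (dslope f x) y = iteratedDeriv n (dslope e x) y + c := by
    intro y hy
    have h1 := nonneg_of_euler hSc hxS hy hderiv hode (fun _ _ => le_rfl)
    have h2 := nonneg_of_euler (n := n) (q := fun _ => 0) hSc hxS hy
      (fun t ht => (hderiv t ht).neg)
      (fun t ht => by simp only [Pi.neg_apply]; linear_combination -(hode t ht))
      (fun _ _ => le_rfl)
    simp only [Pi.neg_apply] at h2
    linarith
  set W : ℝ[X] := (X - C a) ^ s * (C b - X) ^ r with hW
  have hWe : ∀ y, W.eval y = (y - a) ^ s * (b - y) ^ r := fun y => by simp [hW]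
  have hWa : (X - C a) ^ s ∣ W := dvd_mul_right _ _
  have hWb : (X - C b) ^ r ∣ W :=
    (pow_dvd_pow_of_dvd ((dvd_neg.2 dvd_rfl).trans (by rw [neg_sub])) r).trans (dvd_mul_left _ _)
  have hWd : W.natDegree < n := by
    have h1 : ((X - C a) ^ s : ℝ[X]).natDegree ≤ s := by
      simp
    have h2 : ((C b - X) ^ r : ℝ[X]).natDegree ≤ r := by
      have : (C b - X : ℝ[X]).natDegree ≤ 1 := by
        rw [natDegree_sub]; exact (natDegree_X_sub_C b).le
      simpa using natDegree_pow_le_of_le r this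
    have : W.natDegree ≤ s + r := natDegree_mul_le_of_le h1 h2
    omega
  have hzero : ∫ y in a..b, W.eval y * iteratedDeriv n (dslope e x) y = 0 := by
    refine integral_mul_eq_zero_of_boundary (u := fun i y => (derivative^[i] W).eval y)
      (v := fun j => iteratedDeriv j (dslope e x)) n (fun i y _ => ?_)
      (fun j y hy => hek.hasDerivAt_iteratedDeriv j (hIcc hy)) (fun i j hij => ?_)
      (fun i j hij => ?_) (fun y _ => ?_)
    · simp only [Function.iterate_succ_apply']
      exact Polynomial.hasDerivAt _ _
    · rcases lt_or_ge i s with hi | hi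
      · simp only [eval_iterate_derivative_eq_zero_of_pow_dvd hWa hi, zero_mul]
      · simp only [hka j (by omega), mul_zero]
    · rcases lt_or_ge i r with hi | hi
      · simp only [eval_iterate_derivative_eq_zero_of_pow_dvd hWb hi, zero_mul]
      · simp only [hkb j (by omega), mul_zero]
    · simp only [iterate_derivative_eq_zero hWd, eval_zero]
  have hcontW : Continuous fun y : ℝ => (y - a) ^ s * (b - y) ^ r := by fun_prop
  have hconte : ContinuousOn (iteratedDeriv n (dslope e x)) (uIcc a b) := fun y hy =>
    (hek.hasDerivAt_iteratedDeriv n (hIcc hy)).continuousAt.continuousWithinAt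
  calc ∫ y in a..b, (y - a) ^ s * (b - y) ^ r * iteratedDeriv n (dslope f x) y
      = ∫ y in a..b, (W.eval y * iteratedDeriv n (dslope e x) y +
          c * ((y - a) ^ s * (b - y) ^ r)) := by
        refine intervalIntegral.integral_congr fun y hy => ?_
        simp only [hsplit y (hIcc hy), hWe]
        ring
    _ = c * ∫ y in a..b, (y - a) ^ s * (b - y) ^ r := by
        rw [intervalIntegral.integral_add, hzero, zero_add, intervalIntegral.integral_const_mul]
        · exact (W.continuous.continuousOn.mul hconte).intervalIntegrable
        · exact (hcontW.const_mul c).intervalIntegrable _ _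

theorem pow_dvd_of_eval_iterate_derivative_eq_zero {Q : ℝ[X]} {c : ℝ} {r : ℕ}
    (h : ∀ j < r, (derivative^[j] Q).eval c = 0) : (X - C c) ^ r ∣ Q := by
  rcases eq_or_ne Q 0 with rfl | hQ
  · exact dvd_zero _
  rcases r with _ | r
  · simp
  · exact (le_rootMultiplicity_iff hQ).1
      ((lt_rootMultiplicity_iff_isRoot_iterate_derivative hQ).2 fun m hm => h m (by omega))

theorem eq_C_mul_of_eval_iterate_derivative_eq_zero {Q : ℝ[X]} {a b : ℝ} (hab : a ≠ b) {r s : ℕ}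
    (hdeg : Q.natDegree ≤ r + s) (ha : ∀ j < r, (derivative^[j] Q).eval a = 0)
    (hb : ∀ j < s, (derivative^[j] Q).eval b = 0) :
    Q = C (Q.coeff (r + s)) * ((X - C a) ^ r * (X - C b) ^ s) := by
  have hmonic : ((X - C a) ^ r * (X - C b) ^ s : ℝ[X]).Monic :=
    ((monic_X_sub_C a).pow r).mul ((monic_X_sub_C b).pow s)
  have hnat : ((X - C a) ^ r * (X - C b) ^ s : ℝ[X]).natDegree = r + s := by
    rw [((monic_X_sub_C a).pow r).natDegree_mul ((monic_X_sub_C b).pow s)]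
    simp
  have hdvd : (X - C a) ^ r * (X - C b) ^ s ∣ Q :=
    (IsCoprime.pow (isCoprime_X_sub_C_of_isUnit_sub (sub_ne_zero.2 hab).isUnit)).mul_dvd
      (pow_dvd_of_eval_iterate_derivative_eq_zero ha)
      (pow_dvd_of_eval_iterate_derivative_eq_zero hb)
  obtain ⟨T, hT⟩ := hdvd
  have hTdeg : T.natDegree = 0 := by
    rcases eq_or_ne T 0 with rfl | hT0
    · simp
    · have := hmonic.natDegree_mul' hT0
      rw [← hT, hnat] at this
      omega
  obtain ⟨t, rfl⟩ := natDegree_eq_zero.1 hTdeg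
  have hcoeff : Q.coeff (r + s) = t := by
    rw [hT, coeff_mul_C, ← hnat, hmonic.coeff_natDegree, one_mul]
  rw [hcoeff, hT, mul_comm]

theorem continuousOn_of_isDD {f F : ℝ → ℝ} {a b : ℝ} {r s : ℕ}
    (hf : ContinuousOn f (Ioo a b)) (hF : ∀ x ∈ Ioo a b, IsDD f x a b r s (F x)) :
    ContinuousOn F (Ioo a b) := by
  rcases (Ioo a b).eq_empty_or_nonempty with h | ⟨x₀, hx₀⟩
  · simp [h]
  have hab : a < b := hx₀.1.trans hx₀.2
  obtain ⟨H₀, hdeg₀, hD₀, -, ha₀, hb₀⟩ := hF x₀ hx₀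
  have hne : ∀ x ∈ Ioo a b, (x - a) ^ r * (x - b) ^ s ≠ 0 := fun x hx =>
    mul_ne_zero (pow_ne_zero _ (sub_pos.2 hx.1).ne') (pow_ne_zero _ (sub_neg.2 hx.2).ne)
  have hform : EqOn F (fun x => F x₀ + (f x - H₀.eval x) / ((x - a) ^ r * (x - b) ^ s))
      (Ioo a b) := by
    intro x hx
    obtain ⟨H, hdeg, hD, hHx, ha, hb⟩ := hF x hx
    simp only [iteratedDeriv_polynomial] at ha hb ha₀ hb₀
    have hQ := eq_C_mul_of_eval_iterate_derivative_eq_zero (Q := H - H₀) hab.ne (r := r) (s := s)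
      ((natDegree_sub_le _ _).trans (max_le hdeg hdeg₀))
      (fun j hj => by rw [iterate_derivative_sub, eval_sub, ha j hj, ha₀ j hj, sub_self])
      (fun j hj => by rw [iterate_derivative_sub, eval_sub, hb j hj, hb₀ j hj, sub_self])
    have hev := congrArg (eval x) hQ
    simp only [eval_sub, eval_mul, eval_C, eval_pow, eval_X, coeff_sub, hD, hD₀, hHx] at hev
    have := hne x hx
    simp only [hev]
    rw [mul_div_cancel_right₀ _ this]
    ring
  refine ContinuousOn.congr ?_ hform
  exact continuousOn_const.add ((hf.sub H₀.continuous.continuousOn).div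
    (by fun_prop) hne)

/-- A single sign change, positive to negative, is preserved in sign by an increasing ratio. -/
theorem integral_mul_neg_of_strictMonoOn_div {a b α β : ℝ} (hab : a < b) (hα : 0 < α) (hβ : 0 < β)
    {k m : ℕ} (hk : k ≠ 0) {θ₁ θ₂ : ℝ → ℝ} (h₁ : ContinuousOn θ₁ (Icc a b))
    (h₂ : ContinuousOn θ₂ (Icc a b)) (hpos : ∀ y ∈ Icc a b, 0 < θ₁ y)
    (hmono : StrictMonoOn (fun y => θ₂ y / θ₁ y) (Icc a b))
    (hzero : ∫ y in a..b, ((y - a) * (b - y)) ^ m *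
      (α * (b - y) ^ k - β * (y - a) ^ k) * θ₁ y = 0) :
    ∫ y in a..b, ((y - a) * (b - y)) ^ m * (α * (b - y) ^ k - β * (y - a) ^ k) * θ₂ y < 0 := by
  set w : ℝ → ℝ := fun y => α * (b - y) ^ k - β * (y - a) ^ k with hw
  have hwc : Continuous w := by fun_prop
  have hanti : StrictAntiOn w (Icc a b) := by
    intro y hy z hz hyz
    have e1 : (b - z) ^ k < (b - y) ^ k :=
      pow_lt_pow_left₀ (by linarith) (by linarith [hz.2]) hk
    have e2 : (y - a) ^ k < (z - a) ^ k :=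
      pow_lt_pow_left₀ (by linarith) (by linarith [hy.1]) hk
    have := mul_lt_mul_of_pos_left e1 hα
    have := mul_lt_mul_of_pos_left e2 hβ
    simp only [hw]
    linarith
  have hwa : 0 < w a := by
    simp only [hw, sub_self, zero_pow hk, mul_zero, sub_zero]
    exact mul_pos hα (pow_pos (sub_pos.2 hab) k)
  have hwb : w b < 0 := by
    simp only [hw, sub_self, zero_pow hk, mul_zero, zero_sub]
    exact neg_neg_of_pos (mul_pos hβ (pow_pos (sub_pos.2 hab) k))
  obtain ⟨c, hc, hwc0⟩ : (0 : ℝ) ∈ w '' Icc a b :=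
    intermediate_value_Icc' hab.le hwc.continuousOn ⟨hwb.le, hwa.le⟩
  have hac : a < c := lt_of_le_of_ne hc.1 (by rintro rfl; exact hwa.ne' hwc0)
  set R := θ₂ c / θ₁ c with hR
  have hlow : ∀ y ∈ Icc a b, y < c → θ₂ y - R * θ₁ y < 0 := fun y hy hyc => by
    have := hmono hy hc hyc
    rw [div_lt_iff₀ (hpos y hy)] at this
    linarith
  have hhigh : ∀ y ∈ Icc a b, c < y → 0 < θ₂ y - R * θ₁ y := fun y hy hyc => by
    have := hmono hc hy hyc
    rw [lt_div_iff₀ (hpos y hy)] at this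
    linarith
  have hcont : ∀ θ : ℝ → ℝ, ContinuousOn θ (Icc a b) →
      ContinuousOn (fun y => ((y - a) * (b - y)) ^ m * w y * θ y) (Icc a b) := fun θ hθ =>
    ContinuousOn.mul (by fun_prop) hθ
  have hneg : ∫ y in a..b, ((y - a) * (b - y)) ^ m * w y * (θ₂ y - R * θ₁ y) <
      ∫ _ in a..b, (0 : ℝ) := by
    refine intervalIntegral.integral_lt_integral_of_continuousOn_of_le_of_exists_lt hab
      (hcont _ (h₂.sub (continuousOn_const.mul h₁))) continuousOn_const (fun y hy => ?_)
      ⟨(a + c) / 2, ⟨by linarith, by linarith [hc.2]⟩, ?_⟩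
    · have hy' : y ∈ Icc a b := ⟨hy.1.le, hy.2⟩
      have hW : 0 ≤ ((y - a) * (b - y)) ^ m :=
        pow_nonneg (mul_nonneg (sub_nonneg.2 hy'.1) (sub_nonneg.2 hy'.2)) m
      rw [mul_assoc]
      refine mul_nonpos_of_nonneg_of_nonpos hW ?_
      rcases lt_trichotomy y c with h | rfl | h
      · have := hanti hy' hc h
        exact mul_nonpos_of_nonneg_of_nonpos (by linarith) (hlow y hy' h).le
      · rw [hwc0, zero_mul]
      · have := hanti hc hy' h
        exact mul_nonpos_of_nonpos_of_nonneg (by linarith) (hhigh y hy' h).le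
    · have hy' : (a + c) / 2 ∈ Icc a b := ⟨by linarith, by linarith [hc.2]⟩
      have hyc : (a + c) / 2 < c := by linarith
      have := hanti hy' hc hyc
      exact mul_neg_of_pos_of_neg (mul_pos (pow_pos (mul_pos (by linarith) (by linarith [hc.2])) m)
        (by linarith)) (hlow _ hy' hyc)
  have hi := fun θ hθ => (hcont θ hθ).intervalIntegrable_of_Icc (μ := MeasureTheory.volume) hab.le
  calc ∫ y in a..b, ((y - a) * (b - y)) ^ m * w y * θ₂ y
      = ∫ y in a..b, (((y - a) * (b - y)) ^ m * w y * (θ₂ y - R * θ₁ y) +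
          R * (((y - a) * (b - y)) ^ m * w y * θ₁ y)) := by
        refine intervalIntegral.integral_congr fun y _ => ?_
        ring
    _ = ∫ y in a..b, ((y - a) * (b - y)) ^ m * w y * (θ₂ y - R * θ₁ y) := by
        rw [intervalIntegral.integral_add
          (hi (fun y => θ₂ y - R * θ₁ y) (h₂.sub (continuousOn_const.mul h₁)))
          ((hi _ h₁).const_mul R), intervalIntegral.integral_const_mul, hzero, mul_zero, add_zero]
    _ < 0 := by simpa using hneg

/-- The derivative of order `n` of the slope function of `t ↦ t ^ p` at `x`, normalized so that
it is positive. -/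
noncomputable def powDensity (n : ℕ) (p x : ℝ) : ℝ → ℝ := fun y =>
  iteratedDeriv n (dslope (fun t : ℝ => t ^ p) x) y / (descPochhammer ℝ (n + 1)).eval p

theorem analyticOnNhd_rpow_const (p : ℝ) : AnalyticOnNhd ℝ (fun t : ℝ => t ^ p) (Ioi 0) :=
  fun _ ht => (Real.contDiffAt_rpow_const_of_ne (ne_of_gt ht)).analyticAt

theorem eval_descPochhammer_ne_zero {n : ℕ} {p : ℝ} (hp : ∀ k : ℕ, k ≤ n → p ≠ k) :
    (descPochhammer ℝ (n + 1)).eval p ≠ 0 := by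
  rw [descPochhammer_eval_eq_prod_range]
  refine Finset.prod_ne_zero_iff.2 fun k hk => sub_ne_zero.2 (hp k ?_)
  have := Finset.mem_range.1 hk
  omega

theorem hasDerivAt_powDensity (n : ℕ) (p : ℝ) {x t : ℝ} (hx : 0 < x) (ht : 0 < t) :
    HasDerivAt (powDensity n p x) (iteratedDeriv (n + 1) (dslope (fun t : ℝ => t ^ p) x) t /
      (descPochhammer ℝ (n + 1)).eval p) t :=
  (((analyticOnNhd_rpow_const p).dslope_real (mem_Ioi.2 hx)).hasDerivAt_iteratedDeriv n
    (mem_Ioi.2 ht)).div_const _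

theorem powDensity_euler {n : ℕ} {p : ℝ} (hp : ∀ k : ℕ, k ≤ n → p ≠ k) {x t : ℝ} (hx : 0 < x)
    (ht : 0 < t) :
    (t - x) * (iteratedDeriv (n + 1) (dslope (fun t : ℝ => t ^ p) x) t /
      (descPochhammer ℝ (n + 1)).eval p) + (n + 1) * powDensity n p x t = t ^ (p - (n + 1)) := by
  have h := (analyticOnNhd_rpow_const p).iteratedDeriv_succ_eq_dslope isOpen_Ioi
    (mem_Ioi.2 hx) n t (mem_Ioi.2 ht)
  rw [iteratedDeriv_eq_iterate, Real.iter_deriv_rpow_const] at h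
  have hc := eval_descPochhammer_ne_zero hp
  push_cast at h
  simp only [powDensity]
  field_simp
  linear_combination -h

theorem powDensity_pos {n : ℕ} {p : ℝ} (hp : ∀ k : ℕ, k ≤ n → p ≠ k) {x y : ℝ} (hx : 0 < x)
    (hy : 0 < y) : 0 < powDensity n p x y := by
  refine pos_of_euler (convex_Ioi 0) (mem_Ioi.2 hx) (mem_Ioi.2 hy)
    (fun t ht => hasDerivAt_powDensity n p hx ht) (fun t ht => powDensity_euler hp hx ht)
    (fun s hs => Real.rpow_pos_of_pos ?_ _)
  nlinarith [hs.1, hs.2, mul_pos hs.1 hy, mul_pos (sub_pos.2 hs.2) hx]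

theorem strictMonoOn_powDensity_div {n : ℕ} {p₁ p₂ : ℝ} (hp₁ : ∀ k : ℕ, k ≤ n → p₁ ≠ k)
    (hp₂ : ∀ k : ℕ, k ≤ n → p₂ ≠ k) (hp : p₁ < p₂) {x : ℝ} (hx : 0 < x) :
    StrictMonoOn (fun y => powDensity n p₂ x y / powDensity n p₁ x y) (Ioi 0) := by
  refine strictMonoOn_div_of_euler (φ := fun t => t ^ (p₂ - p₁)) (convex_Ioi 0) (mem_Ioi.2 hx)
    (fun t ht => hasDerivAt_powDensity n p₁ hx ht) (fun t ht => hasDerivAt_powDensity n p₂ hx ht)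
    (fun t ht => powDensity_euler hp₁ hx ht) (fun t ht => ?_)
    (fun t ht => Real.rpow_pos_of_pos ht _) (fun s hs t _ hst => ?_)
    (fun t ht => powDensity_pos hp₁ hx ht)
  · rw [powDensity_euler hp₂ hx ht, ← Real.rpow_add ht]
    ring_nf
  · exact Real.rpow_lt_rpow (le_of_lt hs) hst (sub_pos.2 hp)

theorem continuousOn_powDensity (n : ℕ) (p : ℝ) {x : ℝ} (hx : 0 < x) :
    ContinuousOn (powDensity n p x) (Ioi 0) := fun _ ht =>
  (hasDerivAt_powDensity n p hx ht).continuousAt.continuousWithinAt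

theorem IsDD.integral_powDensity {p a b x D : ℝ} {r s n : ℕ} (hn : r + s + 1 = n) (ha : 0 < a)
    (hx : x ∈ Ioo a b) (h : IsDD (fun t : ℝ => t ^ p) x a b (r + 1) (s + 1) D) :
    ∫ y in a..b, (y - a) ^ s * (b - y) ^ r * powDensity n p x y =
      n.factorial * (∫ y in a..b, (y - a) ^ s * (b - y) ^ r) *
        (D / (descPochhammer ℝ (n + 1)).eval p) := by
  subst hn
  have h1 := h.integral_eq isOpen_Ioi (convex_Ioi 0) (analyticOnNhd_rpow_const p) (mem_Ioi.2 ha)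
    (mem_Ioi.2 (ha.trans (hx.1.trans hx.2))) hx
  simp only [powDensity, ← mul_div_assoc]
  rw [intervalIntegral.integral_div, h1]
  ring

theorem integral_pow_mul_pow_comm (a b : ℝ) (r s : ℕ) :
    ∫ y in a..b, (y - a) ^ s * (b - y) ^ r = ∫ y in a..b, (y - a) ^ r * (b - y) ^ s := by
  have h := intervalIntegral.integral_comp_sub_left (a := a) (b := b)
    (fun y => (y - a) ^ r * (b - y) ^ s) (a + b)
  rw [add_sub_cancel_right, add_sub_cancel_left] at h
  rw [← h]
  refine intervalIntegral.integral_congr fun y _ => ?_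
  ring

theorem integral_pow_mul_pow_pos {a b : ℝ} (hab : a < b) (r s : ℕ) :
    0 < ∫ y in a..b, (y - a) ^ s * (b - y) ^ r := by
  refine intervalIntegral.intervalIntegral_pos_of_pos_on
    (Continuous.intervalIntegrable (by fun_prop) _ _) (fun y hy => ?_) hab
  exact mul_pos (pow_pos (sub_pos.2 hy.1) _) (pow_pos (sub_pos.2 hy.2) _)

/-- The defect `α f[x, a ^ (m + k + 1), b ^ (m + 1)] - β f[x, a ^ (m + 1), b ^ (m + k + 1)]` as an
integral. -/
theorem integral_powDensity_defect {p a b x α β D E : ℝ} {m k n : ℕ} (hn : m + k + m + 1 = n)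
    (ha : 0 < a) (hx : x ∈ Ioo a b)
    (hD : IsDD (fun t : ℝ => t ^ p) x a b (m + k + 1) (m + 1) D)
    (hE : IsDD (fun t : ℝ => t ^ p) x a b (m + 1) (m + k + 1) E) :
    ∫ y in a..b, ((y - a) * (b - y)) ^ m * (α * (b - y) ^ k - β * (y - a) ^ k) *
        powDensity n p x y =
      n.factorial * (∫ y in a..b, (y - a) ^ m * (b - y) ^ (m + k)) *
        ((α * D - β * E) / (descPochhammer ℝ (n + 1)).eval p) := by
  have hx0 : 0 < x := ha.trans hx.1
  have hab : a < b := hx.1.trans hx.2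
  have hcont : ContinuousOn (powDensity n p x) (uIcc a b) :=
    (continuousOn_powDensity n p hx0).mono fun y hy => by
      rw [uIcc_of_le hab.le] at hy
      exact mem_Ioi.2 (ha.trans_le hy.1)
  have hi : ∀ r s : ℕ, IntervalIntegrable
      (fun y => (y - a) ^ s * (b - y) ^ r * powDensity n p x y) MeasureTheory.volume a b :=
    fun r s => (ContinuousOn.mul (by fun_prop) hcont).intervalIntegrable
  have h1 := hD.integral_powDensity (n := n) (by omega) ha hx
  have h2 := hE.integral_powDensity (n := n) (by omega) ha hx
  rw [integral_pow_mul_pow_comm a b m (m + k)] at h2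
  calc ∫ y in a..b, ((y - a) * (b - y)) ^ m * (α * (b - y) ^ k - β * (y - a) ^ k) *
        powDensity n p x y
      = ∫ y in a..b, (α * ((y - a) ^ m * (b - y) ^ (m + k) * powDensity n p x y) -
          β * ((y - a) ^ (m + k) * (b - y) ^ m * powDensity n p x y)) := by
        refine intervalIntegral.integral_congr fun y _ => ?_
        simp only [mul_pow, pow_add]
        ring
    _ = _ := by
        rw [intervalIntegral.integral_sub ((hi _ _).const_mul α) ((hi _ _).const_mul β),
          intervalIntegral.integral_const_mul, intervalIntegral.integral_const_mul, h1, h2]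
        ring

/-- Two sided bounds for normalized divided differences of powers, uniform in the free node. -/
theorem exists_bounds_isDD {a b p : ℝ} (ha : 0 < a) (hab : a < b) {n : ℕ}
    (hp : ∀ k : ℕ, k ≤ n → p ≠ k) :
    ∃ l u : ℝ, 0 < l ∧ ∀ r s : ℕ, r + s + 1 = n → ∀ x ∈ Ioo a b, ∀ D : ℝ,
      IsDD (fun t : ℝ => t ^ p) x a b (r + 1) (s + 1) D →
        l ≤ D / (descPochhammer ℝ (n + 1)).eval p ∧ D / (descPochhammer ℝ (n + 1)).eval p ≤ u := by
  have hpos : ∀ t ∈ Icc a b, 0 < t := fun t ht => ha.trans_le ht.1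
  have hcont : ContinuousOn (fun t : ℝ => t ^ (p - (n + 1))) (Icc a b) := fun t ht =>
    (Real.continuousAt_rpow_const _ _ (Or.inl (hpos t ht).ne')).continuousWithinAt
  obtain ⟨t₁, ht₁, hmin⟩ := isCompact_Icc.exists_isMinOn (nonempty_Icc.2 hab.le) hcont
  obtain ⟨t₂, ht₂, hmax⟩ := isCompact_Icc.exists_isMaxOn (nonempty_Icc.2 hab.le) hcont
  have hn0 : (0 : ℝ) < n + 1 := by positivity
  have hfac : (0 : ℝ) < n.factorial := by positivity
  refine ⟨t₁ ^ (p - (n + 1)) / (n + 1) / n.factorial, t₂ ^ (p - (n + 1)) / (n + 1) / n.factorial,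
    div_pos (div_pos (Real.rpow_pos_of_pos (hpos t₁ ht₁) _) hn0) hfac, ?_⟩
  intro r s hrs x hx D hD
  have hx' : x ∈ Icc a b := ⟨hx.1.le, hx.2.le⟩
  have hx0 : 0 < x := hpos x hx'
  have hB := integral_pow_mul_pow_pos hab r s
  have hint := hD.integral_powDensity (n := n) hrs ha hx
  set B := ∫ y in a..b, (y - a) ^ s * (b - y) ^ r with hBdef
  set d := D / (descPochhammer ℝ (n + 1)).eval p
  have hlow : ∀ y ∈ Icc a b, t₁ ^ (p - (n + 1)) / (n + 1) ≤ powDensity n p x y := by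
    intro y hy
    refine sub_nonneg.1 (nonneg_of_euler (n := n)
      (θ := fun y => powDensity n p x y - t₁ ^ (p - (n + 1)) / (n + 1))
      (q := fun t => t ^ (p - (n + 1)) - t₁ ^ (p - (n + 1))) (convex_Icc a b) hx' hy
      (fun t ht => (hasDerivAt_powDensity n p hx0 (hpos t ht)).sub_const _) (fun t ht => ?_)
      (fun t ht => sub_nonneg.2 (hmin ht)))
    rw [← powDensity_euler hp hx0 (hpos t ht), mul_sub, mul_div_cancel₀ _ hn0.ne']
    ring
  have hupp : ∀ y ∈ Icc a b, powDensity n p x y ≤ t₂ ^ (p - (n + 1)) / (n + 1) := by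
    intro y hy
    refine sub_nonneg.1 (nonneg_of_euler (n := n)
      (θ := fun y => t₂ ^ (p - (n + 1)) / (n + 1) - powDensity n p x y)
      (q := fun t => t₂ ^ (p - (n + 1)) - t ^ (p - (n + 1))) (convex_Icc a b) hx' hy
      (fun t ht => (hasDerivAt_powDensity n p hx0 (hpos t ht)).const_sub _) (fun t ht => ?_)
      (fun t ht => sub_nonneg.2 (hmax ht)))
    rw [← powDensity_euler hp hx0 (hpos t ht), mul_sub, mul_div_cancel₀ _ hn0.ne']
    ring
  have hw : ∀ y ∈ Icc a b, 0 ≤ (y - a) ^ s * (b - y) ^ r := fun y hy =>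
    mul_nonneg (pow_nonneg (sub_nonneg.2 hy.1) _) (pow_nonneg (sub_nonneg.2 hy.2) _)
  have hθ : ContinuousOn (powDensity n p x) (uIcc a b) :=
    (continuousOn_powDensity n p hx0).mono fun y hy => by
      rw [uIcc_of_le hab.le] at hy
      exact mem_Ioi.2 (hpos y hy)
  have hi₁ : IntervalIntegrable (fun y => (y - a) ^ s * (b - y) ^ r * powDensity n p x y)
      MeasureTheory.volume a b := (ContinuousOn.mul (by fun_prop) hθ).intervalIntegrable
  have hi₂ : ∀ c : ℝ, IntervalIntegrable (fun y => (y - a) ^ s * (b - y) ^ r * c)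
      MeasureTheory.volume a b := fun c => Continuous.intervalIntegrable (by fun_prop) _ _
  have h1 := intervalIntegral.integral_mono_on hab.le (hi₂ _) hi₁
    (fun y hy => mul_le_mul_of_nonneg_left (hlow y hy) (hw y hy))
  have h2 := intervalIntegral.integral_mono_on hab.le hi₁ (hi₂ _)
    (fun y hy => mul_le_mul_of_nonneg_left (hupp y hy) (hw y hy))
  rw [intervalIntegral.integral_mul_const, hint, ← hBdef, mul_comm _ B, mul_assoc] at h1
  rw [intervalIntegral.integral_mul_const, hint, ← hBdef, mul_comm _ B, mul_assoc] at h2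
  rw [div_le_iff₀ hfac, le_div_iff₀ hfac, mul_comm d]
  exact ⟨le_of_mul_le_mul_left h1 hB, le_of_mul_le_mul_left h2 hB⟩

theorem stmt14 (m₁ m₂ : ℕ) (hm : m₂ < m₁) (a b : ℝ) (ha : 0 < a) (hab : a < b)
    (F G : ℝ → ℝ → ℝ)
    (hF : ∀ p : ℝ, ∀ x ∈ Set.Ioo a b,
      IsDD (fun t => t ^ p) x a b (m₁ + 1) (m₂ + 1) (F p x))
    (hG : ∀ p : ℝ, ∀ x ∈ Set.Ioo a b,
      IsDD (fun t => t ^ p) x a b (m₂ + 1) (m₁ + 1) (G p x))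
    (M : ℝ → ℝ)
    (hM : ∀ p : ℝ, (∀ k : ℕ, k ≤ m₁ + m₂ + 1 → p ≠ (k : ℝ)) →
      M p ∈ Set.Ioo a b ∧ ∀ x ∈ Set.Ioo a b,
        ((x - a) ^ (m₁ - m₂) * F p x = (b - x) ^ (m₁ - m₂) * G p x ↔ x = M p)) :
    ∀ p₁ p₂ : ℝ, (∀ k : ℕ, k ≤ m₁ + m₂ + 1 → p₁ ≠ (k : ℝ)) →
      (∀ k : ℕ, k ≤ m₁ + m₂ + 1 → p₂ ≠ (k : ℝ)) → p₁ < p₂ → M p₁ < M p₂ := by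
  intro p₁ p₂ hp₁ hp₂ hp
  obtain ⟨l, rfl⟩ : ∃ l, m₁ = m₂ + l := ⟨m₁ - m₂, by omega⟩
  have hl : l ≠ 0 := by omega
  simp only [Nat.add_sub_cancel_left] at hM
  set n := m₂ + l + m₂ + 1 with hn
  set c := (descPochhammer ℝ (n + 1)).eval p₂ with hc
  have hc0 : c ≠ 0 := eval_descPochhammer_ne_zero hp₂
  set L : ℝ → ℝ := fun x => ((x - a) ^ l * F p₂ x - (b - x) ^ l * G p₂ x) / c with hL
  have hLM : ∀ x ∈ Set.Ioo a b, L x = 0 → x = M p₂ := by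
    intro x hx h0
    refine ((hM p₂ hp₂).2 x hx).1 (sub_eq_zero.1 ?_)
    exact (div_eq_zero_iff.1 h0).resolve_right hc0
  obtain ⟨hx₁, hroot⟩ := hM p₁ hp₁
  set x₁ := M p₁ with hx₁def
  have hx₁0 : 0 < x₁ := ha.trans hx₁.1
  have hIcc : Set.Icc a b ⊆ Set.Ioi 0 := fun y hy => Set.mem_Ioi.2 (ha.trans_le hy.1)
  have hneg : L x₁ < 0 := by
    have h1 := integral_powDensity_defect (α := (x₁ - a) ^ l) (β := (b - x₁) ^ l) hn.symm ha hx₁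
      (hF p₁ x₁ hx₁) (hG p₁ x₁ hx₁)
    rw [sub_eq_zero.2 ((hroot x₁ hx₁).2 rfl), zero_div, mul_zero] at h1
    have h2 := integral_mul_neg_of_strictMonoOn_div hab (pow_pos (sub_pos.2 hx₁.1) l)
      (pow_pos (sub_pos.2 hx₁.2) l) hl ((continuousOn_powDensity n p₁ hx₁0).mono hIcc)
      ((continuousOn_powDensity n p₂ hx₁0).mono hIcc)
      (fun y hy => powDensity_pos hp₁ hx₁0 (hIcc hy))
      ((strictMonoOn_powDensity_div hp₁ hp₂ hp hx₁0).mono hIcc) h1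
    rw [integral_powDensity_defect hn.symm ha hx₁ (hF p₂ x₁ hx₁) (hG p₂ x₁ hx₁)] at h2
    refine neg_of_mul_neg_right h2 (mul_nonneg (by positivity) ?_)
    exact (integral_pow_mul_pow_pos hab _ _).le
  have hfc : ContinuousOn (fun t : ℝ => t ^ p₂) (Set.Ioo a b) := fun t ht =>
    (Real.continuousAt_rpow_const _ _ (Or.inl (ha.trans ht.1).ne')).continuousWithinAt
  have hLc : ContinuousOn L (Set.Ioo a b) := by
    have hFc := continuousOn_of_isDD hfc (hF p₂)
    have hGc := continuousOn_of_isDD hfc (hG p₂)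
    exact ((ContinuousOn.mul (by fun_prop) hFc).sub
      (ContinuousOn.mul (by fun_prop) hGc)).div_const c
  obtain ⟨x₂, hx₂, hx₁₂, hpos⟩ : ∃ x₂ ∈ Set.Ioo a b, x₁ < x₂ ∧ 0 < L x₂ := by
    obtain ⟨lo, up, hlo, hbd⟩ := exists_bounds_isDD ha hab hp₂
    have hcont : Continuous fun x : ℝ => (x - a) ^ l * lo - (b - x) ^ l * up := by fun_prop
    have hb : 0 < (b - a) ^ l * lo - (b - b) ^ l * up := by
      rw [sub_self, zero_pow hl, zero_mul, sub_zero]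
      exact mul_pos (pow_pos (sub_pos.2 hab) l) hlo
    have hev : ∀ᶠ x in 𝓝[<] b, 0 < (x - a) ^ l * lo - (b - x) ^ l * up :=
      (hcont.continuousAt.eventually (lt_mem_nhds hb)).filter_mono nhdsWithin_le_nhds
    obtain ⟨x, hx, hxb⟩ := (hev.and (Ioo_mem_nhdsLT hx₁.2)).exists
    have hxI : x ∈ Set.Ioo a b := ⟨hx₁.1.trans hxb.1, hxb.2⟩
    refine ⟨x, hxI, hxb.1, hx.trans_le ?_⟩
    have h1 := (hbd (m₂ + l) m₂ (by omega) x hxI _ (hF p₂ x hxI)).1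
    have h2 := (hbd m₂ (m₂ + l) (by omega) x hxI _ (hG p₂ x hxI)).2
    have h3 := mul_le_mul_of_nonneg_left h1 (pow_nonneg (sub_pos.2 hxI.1).le l)
    have h4 := mul_le_mul_of_nonneg_left h2 (pow_nonneg (sub_pos.2 hxI.2).le l)
    simp only [hL, sub_div, mul_div_assoc]
    linarith
  have hsub : Set.Icc x₁ x₂ ⊆ Set.Ioo a b := fun y hy =>
    ⟨hx₁.1.trans_le hy.1, hy.2.trans_lt hx₂.2⟩
  obtain ⟨z, hz, hz0⟩ := intermediate_value_Icc hx₁₂.le (hLc.mono hsub) ⟨hneg.le, hpos.le⟩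
  rw [← hLM z (hsub hz) hz0]
  exact lt_of_le_of_ne hz.1 (by rintro h; rw [← h] at hz0; exact hneg.ne hz0)
end

section
/- For fixed nonnegative integers m₂ < m₁ and fixed 0 < a < b, lim_{p→∞} M_{p,m₁,m₂}(a,b) = b and lim_{p→-∞} M_{p,m₁,m₂}(a,b) = a. -/
open Polynomial Filter Topology

/-- `H` is the Hermite interpolant of `f` of degree less than `r + s` at the nodes `y`
(with multiplicity `r`) and `z` (with multiplicity `s`). -/
structure IsHermite (f : ℝ → ℝ) (y z : ℝ) (r s : ℕ) (H : ℝ[X]) : Prop where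
  degree_lt : H.degree < (r + s : ℕ)
  left : ∀ j < r, (derivative^[j] H).eval y = iteratedDeriv j f y
  right : ∀ j < s, (derivative^[j] H).eval z = iteratedDeriv j f z

lemma iteratedDeriv_polynomial_eval (H : ℝ[X]) (j : ℕ) (t : ℝ) :
    iteratedDeriv j (fun u => H.eval u) t = (derivative^[j] H).eval t := by
  induction j generalizing H with
  | zero => simp
  | succ j ih =>
    rw [iteratedDeriv_succ', Function.iterate_succ_apply, ← ih]
    congr 1
    ext u
    exact H.deriv

lemma eval_iterate_derivative_X_sub_C_pow_mul_of_lt (Q : ℝ[X]) (y : ℝ) {j n : ℕ} (hj : j < n) :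
    (derivative^[j] ((X - C y) ^ n * Q)).eval y = 0 := by
  have h := aeval_iterate_derivative_of_lt (A := ℝ) ((X - C y) ^ n * Q) n y (p' := Q)
    (by simp) hj
  simpa using h

lemma eval_iterate_derivative_X_sub_C_pow_mul_self (Q : ℝ[X]) (y : ℝ) (n : ℕ) :
    (derivative^[n] ((X - C y) ^ n * Q)).eval y = n.factorial * Q.eval y := by
  have h := aeval_iterate_derivative_self (A := ℝ) ((X - C y) ^ n * Q) n y (p' := Q)
    (by simp)
  simpa using h

lemma X_sub_C_pow_dvd_of_iterate_derivative {H : ℝ[X]} {y : ℝ} {r : ℕ}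
    (h : ∀ j < r, (derivative^[j] H).eval y = 0) : (X - C y) ^ r ∣ H := by
  rcases eq_or_ne H 0 with rfl | hH
  · simp
  rw [← le_rootMultiplicity_iff hH]
  cases r with
  | zero => simp
  | succ r =>
    exact (lt_rootMultiplicity_iff_isRoot_iterate_derivative hH).2
      fun m hm => h m (by omega)

lemma eq_zero_of_hermite_data_eq_zero {y z : ℝ} (hyz : y ≠ z) {r s : ℕ} {H : ℝ[X]}
    (hdeg : H.degree < (r + s : ℕ)) (hy : ∀ j < r, (derivative^[j] H).eval y = 0)
    (hz : ∀ j < s, (derivative^[j] H).eval z = 0) : H = 0 := by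
  by_contra hH
  have hcop : IsCoprime ((X - C y) ^ r) ((X - C z) ^ s) :=
    (isCoprime_X_sub_C_of_isUnit_sub (sub_ne_zero.2 hyz).isUnit).pow
  have hdvd := hcop.mul_dvd (X_sub_C_pow_dvd_of_iterate_derivative hy)
    (X_sub_C_pow_dvd_of_iterate_derivative hz)
  have := degree_le_of_dvd hdvd hH
  rw [degree_mul, degree_pow, degree_pow, degree_X_sub_C, degree_X_sub_C] at this
  have h2 := this.trans_lt hdeg
  simp at h2

/-- Hermite interpolants depend continuously on their data: every linear functional of the
interpolant converges when the data converge. -/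
lemma tendsto_of_hermite_data {ι : Type*} {l : Filter ι} {y z : ℝ} (hyz : y ≠ z) {r s : ℕ}
    {H : ι → ℝ[X]} {P : ℝ[X]} (hH : ∀ i, (H i).degree < (r + s : ℕ))
    (hP : P.degree < (r + s : ℕ))
    (hy : ∀ j < r, Tendsto (fun i => (derivative^[j] (H i)).eval y) l
      (𝓝 ((derivative^[j] P).eval y)))
    (hz : ∀ j < s, Tendsto (fun i => (derivative^[j] (H i)).eval z) l
      (𝓝 ((derivative^[j] P).eval z)))
    (φ : ℝ[X] →ₗ[ℝ] ℝ) : Tendsto (fun i => φ (H i)) l (𝓝 (φ P)) := by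
  let ev (t : ℝ) (j : ℕ) : ℝ[X] →ₗ[ℝ] ℝ := (leval t).comp (derivative ^ j)
  have hev (t j Q) : ev t j Q = (derivative^[j] Q).eval t := by
    simp [ev, Module.End.pow_apply, leval_apply]
  let Φ : degreeLT ℝ (r + s) →ₗ[ℝ] (Fin r → ℝ) × (Fin s → ℝ) :=
    ((LinearMap.pi fun j : Fin r => ev y j).prod (LinearMap.pi fun j : Fin s => ev z j)).comp
      (degreeLT ℝ (r + s)).subtype
  have hinj : LinearMap.ker Φ = ⊥ := by
    rw [LinearMap.ker_eq_bot']
    rintro ⟨Q, hQ⟩ h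
    have h1 := congrArg Prod.fst h
    have h2 := congrArg Prod.snd h
    rw [Subtype.ext_iff]
    refine eq_zero_of_hermite_data_eq_zero hyz (mem_degreeLT.1 hQ) (fun j hj => ?_)
      (fun j hj => ?_)
    · rw [← hev]; exact congrFun h1 ⟨j, hj⟩
    · rw [← hev]; exact congrFun h2 ⟨j, hj⟩
  obtain ⟨Ψ, hΨ⟩ := Φ.exists_leftInverse_of_injective hinj
  let χ := (φ.comp (degreeLT ℝ (r + s)).subtype).comp Ψ
  have hχ (Q : ℝ[X]) (hQ : Q.degree < (r + s : ℕ)) : χ (Φ ⟨Q, mem_degreeLT.2 hQ⟩) = φ Q := by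
    have := LinearMap.congr_fun hΨ ⟨Q, mem_degreeLT.2 hQ⟩
    simp only [LinearMap.comp_apply, LinearMap.id_apply] at this
    simp [χ, this]
  have hχc : Continuous χ := χ.continuous_of_finiteDimensional
  have hlim : Tendsto (fun i => Φ ⟨H i, mem_degreeLT.2 (hH i)⟩) l
      (𝓝 (Φ ⟨P, mem_degreeLT.2 hP⟩)) := by
    refine Tendsto.prodMk_nhds (mx := fun i => (Φ ⟨H i, mem_degreeLT.2 (hH i)⟩).1)
      (my := fun i => (Φ ⟨H i, mem_degreeLT.2 (hH i)⟩).2) ?_ ?_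
    · refine tendsto_pi_nhds.2 fun j => ?_
      simpa [Φ, hev] using hy j j.2
    · refine tendsto_pi_nhds.2 fun j => ?_
      simpa [Φ, hev] using hz j j.2
  have := (hχc.tendsto _).comp hlim
  rw [hχ P hP] at this
  exact this.congr fun i => hχ _ (hH i)

lemma iteratedDeriv_rpow_of_pos (p t : ℝ) (j : ℕ) (ht : 0 < t) :
    iteratedDeriv j (fun u : ℝ => u ^ p) t
      = (descPochhammer ℝ j).eval p * (t⁻¹ ^ j * t ^ p) := by
  rw [iteratedDeriv_eq_iterate, Real.iter_deriv_rpow_const, Real.rpow_sub_natCast ht.ne',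
    inv_pow, div_eq_inv_mul]

lemma tendsto_descPochhammer_eval_div_pow {l : Filter ℝ} (hl : Tendsto (fun p : ℝ => p⁻¹) l (𝓝 0))
    (hl0 : ∀ᶠ p in l, p ≠ 0) (j : ℕ) :
    Tendsto (fun p => (descPochhammer ℝ j).eval p * p⁻¹ ^ j) l (𝓝 1) := by
  induction j with
  | zero => simpa using tendsto_const_nhds
  | succ j ih =>
    have h : Tendsto (fun p : ℝ => 1 - j * p⁻¹) l (𝓝 1) := by
      simpa using (hl.const_mul (j : ℝ)).const_sub 1
    have h2 := ih.mul h
    rw [one_mul] at h2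
    refine h2.congr' ?_
    filter_upwards [hl0] with p hp
    rw [descPochhammer_succ_eval, pow_succ]
    linear_combination (-(eval p (descPochhammer ℝ j) * p⁻¹ ^ j)) * mul_inv_cancel₀ hp

/-- The filter `l` of exponents makes `z` dominate all points of the closed segment from `y`
to `z` other than `z` itself. -/
structure Dominates (l : Filter ℝ) (y z : ℝ) : Prop where
  ne_pos : 0 < y ∧ 0 < z ∧ y ≠ z
  inv : Tendsto (fun p : ℝ => p⁻¹) l (𝓝 0)
  sign : ∀ᶠ p in l, p * (y - z) < 0
  decay : ∀ u ∈ Set.uIcc y z, u ≠ z → ∀ k : ℕ,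
    Tendsto (fun p : ℝ => p ^ k * (u ^ p * (z ^ p)⁻¹)) l (𝓝 0)

namespace Dominates

variable {l : Filter ℝ} {y z : ℝ}

lemma eventually_ne (h : Dominates l y z) : ∀ᶠ p in l, p ≠ 0 := by
  filter_upwards [h.sign] with p hp h0
  simp [h0] at hp

/-- Derivatives of `t ^ p` at `z` of order `n` are exactly of size `p ^ n * z ^ p`. -/
lemma tendsto_self (h : Dominates l y z) (n : ℕ) :
    Tendsto (fun p => p⁻¹ ^ n * (z ^ p)⁻¹ * iteratedDeriv n (fun u : ℝ => u ^ p) z) l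
      (𝓝 (z⁻¹ ^ n)) := by
  have hz := h.ne_pos.2.1
  have := (tendsto_descPochhammer_eval_div_pow h.inv h.eventually_ne n).mul_const (z⁻¹ ^ n)
  rw [one_mul] at this
  refine this.congr fun p => ?_
  rw [iteratedDeriv_rpow_of_pos _ _ _ hz]
  have := Real.rpow_pos_of_pos hz p
  field_simp

/-- Derivatives of `t ^ p` at `z` of order less than `n` are of smaller size. -/
lemma tendsto_self_of_lt (h : Dominates l y z) {j n : ℕ} (hj : j < n) :
    Tendsto (fun p => p⁻¹ ^ n * (z ^ p)⁻¹ * iteratedDeriv j (fun u : ℝ => u ^ p) z) l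
      (𝓝 0) := by
  obtain ⟨k, rfl⟩ := Nat.exists_eq_add_of_lt hj
  have := (h.inv.pow (k + 1)).mul (h.tendsto_self j)
  simp only [ne_eq, Nat.add_eq_zero_iff, one_ne_zero, and_false, not_false_eq_true, zero_pow,
    zero_mul] at this
  refine this.congr fun p => ?_
  ring

/-- Derivatives of `t ^ p` away from `z` are negligible. -/
lemma tendsto_other (h : Dominates l y z) {u : ℝ} (hu : u ∈ Set.uIcc y z) (huz : u ≠ z)
    (j n : ℕ) :
    Tendsto (fun p => p⁻¹ ^ n * (z ^ p)⁻¹ * iteratedDeriv j (fun u : ℝ => u ^ p) u) l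
      (𝓝 0) := by
  have hz := h.ne_pos.2.1
  have hu0 : 0 < u := (lt_min h.ne_pos.1 hz).trans_le hu.1
  have := (((tendsto_descPochhammer_eval_div_pow h.inv h.eventually_ne j).mul
    (h.decay u hu huz j)).mul (h.inv.pow n)).mul_const (u⁻¹ ^ j)
  simp only [mul_zero, zero_mul] at this
  refine this.congr' ?_
  filter_upwards [h.eventually_ne] with p hp
  rw [iteratedDeriv_rpow_of_pos _ _ _ hu0]
  have : p⁻¹ ^ j * p ^ j = 1 := by rw [← mul_pow, inv_mul_cancel₀ hp, one_pow]
  linear_combination (eval p (descPochhammer ℝ j) * u ^ p * (z ^ p)⁻¹ * p⁻¹ ^ n * u⁻¹ ^ j) * this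

end Dominates

lemma tendsto_pow_mul_rpow_ratio (k : ℕ) {u z : ℝ} (hu : 0 < u) (huz : u < z) :
    Tendsto (fun p : ℝ => p ^ k * (u ^ p * (z ^ p)⁻¹)) atTop (𝓝 0) := by
  have hc : 0 < Real.log z - Real.log u := sub_pos.2 (Real.log_lt_log hu huz)
  have := tendsto_rpow_mul_exp_neg_mul_atTop_nhds_zero k _ hc
  refine this.congr fun p => ?_
  rw [Real.rpow_natCast, Real.rpow_def_of_pos hu, Real.rpow_def_of_pos (hu.trans huz),
    ← Real.exp_neg, ← Real.exp_add]
  ring_nf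

lemma dominates_atTop {a b : ℝ} (ha : 0 < a) (hab : a < b) : Dominates atTop a b where
  ne_pos := ⟨ha, ha.trans hab, hab.ne⟩
  inv := tendsto_inv_atTop_zero
  sign := by
    filter_upwards [eventually_gt_atTop 0] with p hp
    exact mul_neg_of_pos_of_neg hp (sub_neg.2 hab)
  decay u hu hub k := by
    rw [Set.uIcc_of_le hab.le] at hu
    exact tendsto_pow_mul_rpow_ratio k (ha.trans_le hu.1) (lt_of_le_of_ne hu.2 hub)

lemma dominates_atBot {a b : ℝ} (ha : 0 < a) (hab : a < b) : Dominates atBot b a where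
  ne_pos := ⟨ha.trans hab, ha, hab.ne'⟩
  inv := tendsto_inv_atBot_zero
  sign := by
    filter_upwards [eventually_lt_atBot 0] with p hp
    exact mul_neg_of_neg_of_pos hp (sub_pos.2 hab)
  decay u hu hua k := by
    rw [Set.uIcc_of_ge hab.le] at hu
    have hlt : a < u := lt_of_le_of_ne hu.1 hua.symm
    have h := ((tendsto_pow_mul_rpow_ratio k (inv_pos.2 (ha.trans hlt))
      (inv_strictAnti₀ ha hlt)).comp tendsto_neg_atBot_atTop).const_mul ((-1 : ℝ) ^ k)
    rw [mul_zero] at h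
    refine h.congr fun p => ?_
    simp only [Function.comp_apply]
    rw [Real.inv_rpow (ha.trans hlt).le, Real.inv_rpow ha.le, Real.rpow_neg (ha.trans hlt).le,
      Real.rpow_neg ha.le, inv_inv, inv_inv, ← mul_assoc, ← mul_pow]
    simp

/-- Leading Taylor behaviour of a function on the positive half-line at a zero of order `n`. -/
lemma tendsto_div_pow_of_iteratedDeriv {g : ℝ → ℝ} {z : ℝ} (hz : 0 < z) (n : ℕ)
    (hg : ContDiffOn ℝ n g (Set.Ioi 0)) (h0 : ∀ j < n, iteratedDeriv j g z = 0) :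
    Tendsto (fun x => g x / (x - z) ^ n) (𝓝[≠] z) (𝓝 (iteratedDeriv n g z / n.factorial)) := by
  have hT := Real.taylor_tendsto (convex_Ioi (0 : ℝ)) (Set.mem_Ioi.2 hz) hg
  rw [isOpen_Ioi.nhdsWithin_eq (Set.mem_Ioi.2 hz)] at hT
  have hT' := (hT.mono_left (nhdsWithin_le_nhds (s := {z}ᶜ))).add_const
    (iteratedDeriv n g z / n.factorial)
  rw [zero_add] at hT'
  refine hT'.congr' ?_
  filter_upwards [self_mem_nhdsWithin] with x hx
  have hxz : (x - z) ^ n ≠ 0 := pow_ne_zero _ (sub_ne_zero.2 hx)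
  have hval : taylorWithinEval g n (Set.Ioi 0) z x
      = iteratedDeriv n g z / n.factorial * (x - z) ^ n := by
    have hw (j : ℕ) : iteratedDerivWithin j g (Set.Ioi 0) z = iteratedDeriv j g z :=
      iteratedDerivWithin_of_isOpen isOpen_Ioi hz
    rw [taylor_within_apply, Finset.sum_range_succ, Finset.sum_eq_zero, zero_add, hw, smul_eq_mul]
    · field_simp
    · intro j hj
      rw [hw, h0 j (Finset.mem_range.1 hj), smul_zero]
  rw [hval]
  field_simp
  ring

lemma IsHermite.tendsto_scaled {l : Filter ℝ} {y z : ℝ} (hd : Dominates l y z) {r s n : ℕ}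
    (hn : s ≤ n) {H : ℝ → ℝ[X]} (hH : ∀ p, IsHermite (fun t => t ^ p) y z r s (H p))
    (φ : ℝ[X] →ₗ[ℝ] ℝ) : Tendsto (fun p => p⁻¹ ^ n * (z ^ p)⁻¹ * φ (H p)) l (𝓝 0) := by
  have h := tendsto_of_hermite_data (l := l) hd.ne_pos.2.2 (r := r) (s := s)
    (H := fun p => (p⁻¹ ^ n * (z ^ p)⁻¹) • H p) (P := 0)
    (fun p => (degree_smul_le _ _).trans_lt (hH p).degree_lt) (by simp [bot_lt_iff_ne_bot])
    (fun j hj => ?_) (fun j hj => ?_) φ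
  · simpa using h
  · simpa [iterate_derivative_smul, (hH _).left j hj] using
      hd.tendsto_other Set.left_mem_uIcc hd.ne_pos.2.2 j n
  · simpa [iterate_derivative_smul, (hH _).right j hj] using
      hd.tendsto_self_of_lt (hj.trans_le hn)

lemma IsHermite.tendsto_eval {l : Filter ℝ} {y z : ℝ} (hd : Dominates l y z) {r n : ℕ}
    {H : ℝ → ℝ[X]} (hH : ∀ p, IsHermite (fun t => t ^ p) y z r (n + 1) (H p)) (x : ℝ) :
    Tendsto (fun p => p⁻¹ ^ n * (z ^ p)⁻¹ * (H p).eval x) l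
      (𝓝 ((x - z) ^ n * ((x - y) / (z - y)) ^ r * (z⁻¹ ^ n / n.factorial))) := by
  have hyz := hd.ne_pos.2.2
  have hzy : z - y ≠ 0 := sub_ne_zero.2 hyz.symm
  set c : ℝ := z⁻¹ ^ n / n.factorial / (z - y) ^ r with hc
  have hQ : (X - C z) ^ n * ((X - C y) ^ r * C c) = (X - C y) ^ r * ((X - C z) ^ n * C c) := by
    ring
  have h := tendsto_of_hermite_data (l := l) hyz (r := r) (s := n + 1)
    (H := fun p => (p⁻¹ ^ n * (z ^ p)⁻¹) • H p) (P := (X - C z) ^ n * ((X - C y) ^ r * C c))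
    (fun p => (degree_smul_le _ _).trans_lt (hH p).degree_lt) ?_
    (fun j hj => ?_) (fun j hj => ?_) (leval x)
  · convert h using 2
    · simp [leval_apply]
    · simp only [leval_apply, eval_mul, eval_pow, eval_sub, eval_X, eval_C, hc, div_pow]
      ring
  · refine lt_of_le_of_lt (b := ((n + r : ℕ) : WithBot ℕ)) ?_ (by norm_cast; omega)
    refine degree_le_of_natDegree_le ?_
    compute_degree
  · rw [hQ, eval_iterate_derivative_X_sub_C_pow_mul_of_lt _ _ hj]
    simpa [iterate_derivative_smul, (hH _).left j hj] using
      hd.tendsto_other Set.left_mem_uIcc hyz j n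
  · rcases Nat.lt_succ_iff_lt_or_eq.1 hj with hj' | rfl
    · rw [eval_iterate_derivative_X_sub_C_pow_mul_of_lt _ _ hj']
      simpa [iterate_derivative_smul, (hH _).right j hj] using hd.tendsto_self_of_lt hj'
    · rw [eval_iterate_derivative_X_sub_C_pow_mul_self]
      have hval : (j.factorial : ℝ) * eval z ((X - C y) ^ r * C c) = z⁻¹ ^ j := by
        simp only [eval_mul, eval_pow, eval_sub, eval_X, eval_C, hc]
        field_simp
      rw [hval]
      simpa [iterate_derivative_smul, (hH _).right j hj] using hd.tendsto_self j

lemma sub_mul_sub_pos_of_mem_uIcc {x y z : ℝ} (hx : x ∈ Set.uIcc y z) (hxz : x ≠ z) :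
    0 < (x - z) * (y - z) := by
  rcases Set.mem_uIcc.1 hx with h | h
  · have := lt_of_le_of_ne h.2 hxz
    exact mul_pos_of_neg_of_neg (by linarith) (by linarith)
  · have := lt_of_le_of_ne h.1 hxz.symm
    exact mul_pos (by linarith) (by linarith)

lemma exists_mem_uIcc_of_eventually_nhdsNE {x₀ z : ℝ} (h : x₀ ≠ z) {P : ℝ → Prop}
    (hP : ∀ᶠ x in 𝓝[≠] z, P x) : ∃ x ∈ Set.uIcc x₀ z, x ≠ z ∧ P x := by
  rcases lt_or_gt_of_ne h with h | h
  · obtain ⟨x, hx, hPx⟩ := ((Filter.Eventually.and (Ioo_mem_nhdsLT h : Set.Ioo x₀ z ∈ 𝓝[<] z)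
      (hP.filter_mono (nhdsWithin_mono z fun x hx => ne_of_lt hx)))).exists
    exact ⟨x, Set.mem_uIcc.2 (.inl ⟨hx.1.le, hx.2.le⟩), hx.2.ne, hPx⟩
  · obtain ⟨x, hx, hPx⟩ := ((Filter.Eventually.and (Ioo_mem_nhdsGT h : Set.Ioo z x₀ ∈ 𝓝[>] z)
      (hP.filter_mono (nhdsWithin_mono z fun x hx => ne_of_gt hx)))).exists
    exact ⟨x, Set.mem_uIcc.2 (.inr ⟨hx.1.le, hx.2.le⟩), hx.1.ne', hPx⟩

/-- If `z` dominates, the two interpolation errors balance at some point arbitrarily close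
to `z`. -/
lemma Dominates.exists_balanced {l : Filter ℝ} {y z : ℝ} (hd : Dominates l y z) {S d : ℕ}
    (hd0 : 0 < d) {K L : ℝ → ℝ[X]}
    (hK : ∀ p, IsHermite (fun t => t ^ p) y z (S + d) S (K p))
    (hL : ∀ p, IsHermite (fun t => t ^ p) y z S (S + d) (L p))
    {x₀ : ℝ} (hx₀ : x₀ ∈ Set.uIcc y z) (hx₀y : x₀ ≠ y) (hx₀z : x₀ ≠ z) :
    ∀ᶠ p in l, ∃ x ∈ Set.uIcc x₀ z, x ≠ z ∧
      x ^ p - (K p).eval x = (-1) ^ d * (x ^ p - (L p).eval x) := by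
  obtain ⟨e, rfl⟩ : ∃ e, d = e + 1 := ⟨d - 1, by omega⟩
  have hz : 0 < z := hd.ne_pos.2.1
  have hy : 0 < y := hd.ne_pos.1
  let g (p x : ℝ) : ℝ := (x ^ p - (K p).eval x) - (-1) ^ (e + 1) * (x ^ p - (L p).eval x)
  have hpos (x : ℝ) (hx : x ∈ Set.uIcc y z) : 0 < x := (lt_min hy hz).trans_le hx.1
  have hrpow (p x : ℝ) (hx : 0 < x) (n : ℕ) : ContDiffAt ℝ n (fun t : ℝ => t ^ p) x :=
    Real.contDiffAt_rpow_const_of_ne hx.ne'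
  have hpoly (Q : ℝ[X]) (x : ℝ) (n : ℕ) : ContDiffAt ℝ n (fun t : ℝ => Q.eval t) x :=
    (by simpa using Q.contDiff_aeval (𝕜 := ℝ) n : ContDiff ℝ n fun t : ℝ => Q.eval t).contDiffAt
  have hderiv (p : ℝ) (j : ℕ) : iteratedDeriv j (g p) z =
      (iteratedDeriv j (fun t : ℝ => t ^ p) z - (derivative^[j] (K p)).eval z) -
      (-1) ^ (e + 1) *
        (iteratedDeriv j (fun t : ℝ => t ^ p) z - (derivative^[j] (L p)).eval z) := by
    have h1 (Q : ℝ[X]) : ContDiffAt ℝ j (fun t : ℝ => t ^ p - Q.eval t) z :=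
      (hrpow p z hz j).sub (hpoly Q z j)
    rw [← iteratedDeriv_polynomial_eval, ← iteratedDeriv_polynomial_eval,
      ← iteratedDeriv_fun_sub (hrpow p z hz j) (hpoly _ z j),
      ← iteratedDeriv_fun_sub (hrpow p z hz j) (hpoly _ z j),
      ← iteratedDeriv_const_mul _ (h1 _),
      ← iteratedDeriv_fun_sub (h1 _) (contDiffAt_const.mul (h1 _))]
  have hzero (p : ℝ) (j : ℕ) (hj : j < S) : iteratedDeriv j (g p) z = 0 := by
    rw [hderiv, (hK p).right j hj, (hL p).right j (by omega)]
    simp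
  have hlead (p : ℝ) : iteratedDeriv S (g p) z =
      iteratedDeriv S (fun t : ℝ => t ^ p) z - (derivative^[S] (K p)).eval z := by
    rw [hderiv, (hL p).right S (by omega)]
    simp
  -- the size of the leading derivative at the dominant node
  have hB : Tendsto (fun p => p⁻¹ ^ S * (z ^ p)⁻¹ * iteratedDeriv S (g p) z) l
      (𝓝 (z⁻¹ ^ S)) := by
    have h1 := IsHermite.tendsto_scaled hd le_rfl hK ((leval z).comp (derivative ^ S))
    have h2 := (hd.tendsto_self S).sub h1
    rw [sub_zero] at h2
    refine h2.congr fun p => ?_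
    rw [hlead, LinearMap.comp_apply, Module.End.pow_apply, leval_apply]
    ring
  -- the size of the error difference at the interior point
  have hA : Tendsto (fun p => p⁻¹ ^ (S + e) * (z ^ p)⁻¹ * g p x₀) l
      (𝓝 ((-1) ^ (e + 1) *
        ((x₀ - z) ^ (S + e) * ((x₀ - y) / (z - y)) ^ S * (z⁻¹ ^ (S + e) / (S + e).factorial)))) := by
    have h1 := IsHermite.tendsto_scaled hd (Nat.le_add_right S e) hK (leval x₀)
    have h2 := IsHermite.tendsto_eval hd (n := S + e) hL x₀
    have h3 := hd.tendsto_other hx₀ hx₀z 0 (S + e)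
    have h4 := (h3.sub h1).sub ((h3.sub h2).const_mul ((-1 : ℝ) ^ (e + 1)))
    convert h4 using 2
    · simp only [iteratedDeriv_zero, leval_apply, g]
      ring
    · ring
  set A : ℝ := ((x₀ - y) / (z - y)) ^ S * (z⁻¹ ^ (S + e) / (S + e).factorial) with hAdef
  have hApos : 0 < A := by
    have h1 := sub_mul_sub_pos_of_mem_uIcc (Set.uIcc_comm y z ▸ hx₀) hx₀y
    have h2 : 0 < (x₀ - y) / (z - y) := by
      rcases mul_pos_iff.1 h1 with h | h
      · exact div_pos h.1 h.2
      · exact div_pos_of_neg_of_neg h.1 h.2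
    positivity
  have hA' := hA.mul_const ((-1) ^ (e + 1) * (x₀ - z) ^ (S + e))
  have hlim : 0 < (-1) ^ (e + 1) *
        ((x₀ - z) ^ (S + e) * ((x₀ - y) / (z - y)) ^ S * (z⁻¹ ^ (S + e) / (S + e).factorial)) *
        ((-1) ^ (e + 1) * (x₀ - z) ^ (S + e)) := by
    have h1 : (-1 : ℝ) ^ (e + 1) * (x₀ - z) ^ (S + e) ≠ 0 :=
      mul_ne_zero (pow_ne_zero _ (by norm_num)) (pow_ne_zero _ (sub_ne_zero.2 hx₀z))
    calc (0 : ℝ) < ((-1 : ℝ) ^ (e + 1) * (x₀ - z) ^ (S + e)) ^ 2 * A := by positivity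
      _ = _ := by rw [hAdef]; ring
  filter_upwards [hd.sign, hA'.eventually_const_lt hlim,
    hB.eventually_const_lt (show 0 < z⁻¹ ^ S by positivity)] with p hp hpA hpB
  have hzp : 0 < z ^ p := Real.rpow_pos_of_pos hz p
  have hp0 : p ≠ 0 := by rintro rfl; simp at hp
  have hside (x : ℝ) (hx : x ∈ Set.uIcc y z) (hxz : x ≠ z) : 0 < -(p⁻¹ * (x - z)) := by
    have h1 := sub_mul_sub_pos_of_mem_uIcc hx hxz
    have h2 : p * (x - z) < 0 := by
      by_contra! h3
      have : 0 < (y - z) ^ 2 := by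
        have : y - z ≠ 0 := sub_ne_zero.2 hd.ne_pos.2.2
        positivity
      nlinarith [mul_nonneg h3 h1.le, mul_pos h1 h1, mul_pos (neg_pos.2 hp) h1,
        sq_pos_of_ne_zero (sub_ne_zero.2 hxz)]
    have h4 : p⁻¹ * (x - z) = (p ^ 2)⁻¹ * (p * (x - z)) := by field_simp
    rw [h4, ← mul_neg]
    have : 0 < -(p * (x - z)) := neg_pos.2 h2
    positivity
  have hneg : (-1) ^ S * g p x₀ < 0 := by
    have h1 := hside x₀ hx₀ hx₀z
    have h2 : 0 < (-(p⁻¹ * (x₀ - z))) ^ (S + e) * (z ^ p)⁻¹ := by positivity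
    have h3 : (-(p⁻¹ * (x₀ - z))) ^ (S + e) * (z ^ p)⁻¹ * ((-1) ^ S * g p x₀) =
        -(p⁻¹ ^ (S + e) * (z ^ p)⁻¹ * g p x₀ * ((-1) ^ (e + 1) * (x₀ - z) ^ (S + e))) := by
      have : ((-1 : ℝ) ^ S) ^ 2 = 1 := by rw [← pow_mul, mul_comm, pow_mul]; simp
      rw [neg_pow, mul_pow, pow_add (-1 : ℝ) S e, pow_succ (-1 : ℝ) e]
      linear_combination ((-1) ^ e * p⁻¹ ^ (S + e) * (x₀ - z) ^ (S + e) * (z ^ p)⁻¹ * g p x₀) * this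
    by_contra! h4
    have := mul_nonneg h2.le h4
    linarith
  set c := iteratedDeriv S (g p) z
  have hc0 : c ≠ 0 := by
    intro h
    simp [h] at hpB
  have hnear := (tendsto_div_pow_of_iteratedDeriv hz S (g := g p) (fun x hx =>
    (((hrpow p x hx S).sub (hpoly _ x S)).sub
      (contDiffAt_const.mul ((hrpow p x hx S).sub (hpoly _ x S)))).contDiffWithinAt)
    (hzero p)).mul_const c
  have hnear_pos : 0 < c / S.factorial * c := by
    rw [div_mul_eq_mul_div, ← sq]
    positivity
  obtain ⟨x₁, hx₁, hx₁z, hgx₁⟩ := exists_mem_uIcc_of_eventually_nhdsNE hx₀z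
    (hnear.eventually_const_lt hnear_pos)
  have hx₁' : x₁ ∈ Set.uIcc y z := Set.uIcc_subset_uIcc_right hx₀ hx₁
  have hposg : 0 < (-1) ^ S * g p x₁ := by
    have h1 := hside x₁ hx₁' hx₁z
    have hx₁S : (x₁ - z) ^ S ≠ 0 := pow_ne_zero _ (sub_ne_zero.2 hx₁z)
    have h2 := mul_pos (mul_pos hgx₁ hpB) (show 0 < ((x₁ - z) ^ S) ^ 2 by positivity)
    have h3 : 0 < (-(p⁻¹ * (x₁ - z))) ^ S * ((z ^ p)⁻¹ * c ^ 2) := by positivity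
    have h4 : g p x₁ / (x₁ - z) ^ S * c * (p⁻¹ ^ S * (z ^ p)⁻¹ * c) * ((x₁ - z) ^ S) ^ 2 =
        (-(p⁻¹ * (x₁ - z))) ^ S * ((z ^ p)⁻¹ * c ^ 2) * ((-1) ^ S * g p x₁) := by
      have h5 : ((-1 : ℝ) ^ S) ^ 2 = 1 := by rw [← pow_mul, mul_comm, pow_mul]; simp
      have h6 : g p x₁ / (x₁ - z) ^ S * ((x₁ - z) ^ S) ^ 2 = g p x₁ * (x₁ - z) ^ S := by
        field_simp
      rw [neg_pow, mul_pow]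
      linear_combination (c * (p⁻¹ ^ S * (z ^ p)⁻¹ * c)) * h6 -
        (p⁻¹ ^ S * (x₁ - z) ^ S * ((z ^ p)⁻¹ * c ^ 2) * g p x₁) * h5
    rw [h4] at h2
    exact (pos_iff_pos_of_mul_pos h2).1 h3
  have hsub : Set.uIcc x₀ x₁ ⊆ Set.uIcc x₀ z := Set.uIcc_subset_uIcc_left hx₁
  have hcont : ContinuousOn (fun x => (-1) ^ S * g p x) (Set.uIcc x₀ x₁) := fun x hx => by
    have hx0 := hpos x (Set.uIcc_subset_uIcc_right hx₀ (hsub hx))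
    exact (contDiffAt_const.mul (((hrpow p x hx0 0).sub (hpoly _ x 0)).sub
      (contDiffAt_const.mul ((hrpow p x hx0 0).sub
        (hpoly _ x 0))))).continuousAt.continuousWithinAt
  obtain ⟨x, hx, hgx⟩ := intermediate_value_uIcc hcont
    (Set.mem_uIcc.2 (.inl ⟨hneg.le, hposg.le⟩))
  refine ⟨x, hsub hx, ?_, ?_⟩
  · rintro rfl
    have h1 := sub_mul_sub_pos_of_mem_uIcc hx₁ hx₁z
    rcases Set.mem_uIcc.1 hx with h | h <;> nlinarith
  · have : g p x = 0 := by simpa using hgx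
    exact sub_eq_zero.1 this

lemma IsHermite.symm {f : ℝ → ℝ} {y z : ℝ} {r s : ℕ} {H : ℝ[X]} (h : IsHermite f y z r s H) :
    IsHermite f z y s r H :=
  ⟨by rw [add_comm]; exact h.degree_lt, h.right, h.left⟩

/-- Dropping the node `x` from a divided difference leaves a Hermite interpolant, whose error at
`x` is the divided difference times the nodal polynomial. -/
lemma IsDD.exists_isHermite {f : ℝ → ℝ} {x y z : ℝ} {r s : ℕ} {D : ℝ}
    (h : IsDD f x y z r s D) :
    ∃ H, IsHermite f y z r s H ∧ f x - H.eval x = D * ((x - y) ^ r * (x - z) ^ s) := by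
  obtain ⟨H, hdeg, hD, hx, hy, hz⟩ := h
  set N : ℝ[X] := (X - C y) ^ r * (X - C z) ^ s with hN
  have hNmonic : N.Monic := ((monic_X_sub_C y).pow r).mul ((monic_X_sub_C z).pow s)
  have hNdeg : N.natDegree = r + s := by
    rw [hN, ((monic_X_sub_C y).pow r).natDegree_mul ((monic_X_sub_C z).pow s)]
    simp
  refine ⟨H - D • N, ⟨?_, fun j hj => ?_, fun j hj => ?_⟩, ?_⟩
  · rw [degree_lt_iff_coeff_zero]
    intro m hm
    rcases hm.eq_or_lt with rfl | hm
    · have : N.coeff (r + s) = 1 := hNdeg ▸ hNmonic.coeff_natDegree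
      simp [hD, this]
    · simp [coeff_eq_zero_of_natDegree_lt (hdeg.trans_lt hm),
        coeff_eq_zero_of_natDegree_lt (hNdeg.trans_lt hm)]
  · rw [← hy j hj, iteratedDeriv_polynomial_eval, iterate_derivative_sub,
      iterate_derivative_smul, hN, eval_sub, eval_smul,
      eval_iterate_derivative_X_sub_C_pow_mul_of_lt _ _ hj]
    simp
  · rw [← hz j hj, iteratedDeriv_polynomial_eval, iterate_derivative_sub,
      iterate_derivative_smul, hN, mul_comm, eval_sub, eval_smul,
      eval_iterate_derivative_X_sub_C_pow_mul_of_lt _ _ hj]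
    simp
  · simp [hN, hx]

lemma IsHermite.unique {f : ℝ → ℝ} {y z : ℝ} (hyz : y ≠ z) {r s : ℕ} {H H' : ℝ[X]}
    (h : IsHermite f y z r s H) (h' : IsHermite f y z r s H') : H = H' := by
  refine sub_eq_zero.1 (eq_zero_of_hermite_data_eq_zero hyz (r := r) (s := s)
    ((degree_sub_le _ _).trans_lt (max_lt h.degree_lt h'.degree_lt)) (fun j hj => ?_)
    (fun j hj => ?_))
  · rw [iterate_derivative_sub, eval_sub, h.left j hj, h'.left j hj, sub_self]
  · rw [iterate_derivative_sub, eval_sub, h.right j hj, h'.right j hj, sub_self]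

/-- A family of divided differences over all `x` in an interval comes from a single Hermite
interpolant for each exponent. -/
lemma exists_isHermite_family {a b : ℝ} (hab : a < b) {r s : ℕ} {F : ℝ → ℝ → ℝ}
    (hF : ∀ p : ℝ, ∀ x ∈ Set.Ioo a b, IsDD (fun t => t ^ p) x a b r s (F p x)) :
    ∃ K : ℝ → ℝ[X], (∀ p, IsHermite (fun t => t ^ p) a b r s (K p)) ∧
      ∀ p, ∀ x ∈ Set.Ioo a b, x ^ p - (K p).eval x = F p x * ((x - a) ^ r * (x - b) ^ s) := by
  obtain ⟨x, hx⟩ := exists_between hab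
  choose K hK _ using fun p => (hF p x hx).exists_isHermite
  refine ⟨K, hK, fun p u hu => ?_⟩
  obtain ⟨H, hH, hval⟩ := (hF p u hu).exists_isHermite
  rwa [(hK p).unique hab.ne hH]

theorem stmt15 (m₁ m₂ : ℕ) (hm : m₂ < m₁) (a b : ℝ) (ha : 0 < a) (hab : a < b)
    (F G : ℝ → ℝ → ℝ)
    (hF : ∀ p : ℝ, ∀ x ∈ Set.Ioo a b,
      IsDD (fun t => t ^ p) x a b (m₁ + 1) (m₂ + 1) (F p x))
    (hG : ∀ p : ℝ, ∀ x ∈ Set.Ioo a b,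
      IsDD (fun t => t ^ p) x a b (m₂ + 1) (m₁ + 1) (G p x))
    (M : ℝ → ℝ)
    (hM : ∀ p : ℝ, (∀ k : ℕ, k ≤ m₁ + m₂ + 1 → p ≠ (k : ℝ)) →
      M p ∈ Set.Ioo a b ∧ ∀ x ∈ Set.Ioo a b,
        ((x - a) ^ (m₁ - m₂) * F p x = (b - x) ^ (m₁ - m₂) * G p x ↔ x = M p)) :
    Filter.Tendsto M Filter.atTop (nhds b) ∧ Filter.Tendsto M Filter.atBot (nhds a) := by
  obtain ⟨d, rfl⟩ := Nat.exists_eq_add_of_lt hm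
  obtain ⟨K, hK, hKF⟩ := exists_isHermite_family hab hF
  obtain ⟨L, hL, hLG⟩ := exists_isHermite_family hab hG
  have hdeg : m₂ + d + 1 + 1 = m₂ + 1 + (d + 1) := by ring
  rw [hdeg] at hK hL hKF hLG
  have hsub : m₂ + d + 1 - m₂ = d + 1 := by omega
  rw [hsub] at hM
  have hσ : ((-1 : ℝ) ^ (d + 1)) ^ 2 = 1 := by rw [← pow_mul, mul_comm, pow_mul]; simp
  have hkey (p x : ℝ) (hx : x ∈ Set.Ioo a b)
      (h : x ^ p - (K p).eval x = (-1) ^ (d + 1) * (x ^ p - (L p).eval x)) :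
      (x - a) ^ (d + 1) * F p x = (b - x) ^ (d + 1) * G p x := by
    rw [hKF p x hx, hLG p x hx] at h
    have h0 : (x - a) ^ (m₂ + 1) * (x - b) ^ (m₂ + 1) ≠ 0 :=
      mul_ne_zero (pow_ne_zero _ (sub_ne_zero.2 hx.1.ne'))
        (pow_ne_zero _ (sub_ne_zero.2 hx.2.ne))
    refine mul_left_cancel₀ h0 ?_
    rw [← neg_sub x b, neg_pow (x - b) (d + 1)]
    rw [pow_add (x - a), pow_add (x - b)] at h
    linear_combination h
  constructor
  · refine tendsto_order.2 ⟨fun u hu => ?_, fun u hu => ?_⟩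
    · obtain ⟨x₀, hx₀, hx₀b⟩ := exists_between (max_lt hu hab)
      have hax₀ : a < x₀ := (le_max_right _ _).trans_lt hx₀
      have hux₀ : u < x₀ := (le_max_left _ _).trans_lt hx₀
      filter_upwards [(dominates_atTop ha hab).exists_balanced d.succ_pos hK hL
        (Set.mem_uIcc.2 (.inl ⟨hax₀.le, hx₀b.le⟩)) hax₀.ne' hx₀b.ne,
        eventually_gt_atTop ((m₂ + d + 1 + m₂ + 1 : ℕ) : ℝ)] with p ⟨x, hx, hxb, hbal⟩ hp
      rw [Set.uIcc_of_le hx₀b.le] at hx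
      have hxI : x ∈ Set.Ioo a b := ⟨hax₀.trans_le hx.1, lt_of_le_of_ne hx.2 hxb⟩
      have hMp := hM p fun k hk => ((Nat.cast_le.2 hk).trans_lt hp).ne'
      rw [← (hMp.2 x hxI).1 (hkey p x hxI hbal)]
      exact hux₀.trans_le hx.1
    · filter_upwards [eventually_gt_atTop ((m₂ + d + 1 + m₂ + 1 : ℕ) : ℝ)] with p hp
      exact (hM p fun k hk => ((Nat.cast_le.2 hk).trans_lt hp).ne').1.2.trans hu
  · refine tendsto_order.2 ⟨fun u hu => ?_, fun u hu => ?_⟩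
    · filter_upwards [eventually_lt_atBot 0] with p hp
      exact hu.trans (hM p fun k _ => (hp.trans_le k.cast_nonneg).ne).1.1
    · obtain ⟨x₀, hx₀a, hx₀⟩ := exists_between (lt_min hu hab)
      have hx₀b : x₀ < b := hx₀.trans_le (min_le_right _ _)
      have hux₀ : x₀ < u := hx₀.trans_le (min_le_left _ _)
      filter_upwards [(dominates_atBot ha hab).exists_balanced d.succ_pos
        (fun p => (hL p).symm) (fun p => (hK p).symm)
        (Set.mem_uIcc.2 (.inr ⟨hx₀a.le, hx₀b.le⟩)) hx₀b.ne hx₀a.ne',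
        eventually_lt_atBot 0] with p ⟨x, hx, hxa, hbal⟩ hp
      rw [Set.uIcc_of_ge hx₀a.le] at hx
      have hxI : x ∈ Set.Ioo a b := ⟨lt_of_le_of_ne hx.1 hxa.symm, hx.2.trans_lt hx₀b⟩
      have hMp := hM p fun k _ => (hp.trans_le k.cast_nonneg).ne
      have hbal' : x ^ p - (K p).eval x = (-1) ^ (d + 1) * (x ^ p - (L p).eval x) := by
        rw [hbal, Nat.succ_eq_add_one]
        linear_combination (-(x ^ p - (K p).eval x)) * hσ
      rw [← (hMp.2 x hxI).1 (hkey p x hxI hbal')]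
      exact hx.2.trans_lt hux₀
end
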